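/- There exist constants C > 0 and c > 0 such that for every positive integer N and every nonempty set A ⊆ {1,…,N} with |A| = αN, the threefold sumset A + A + A contains an arithmetic progression (with nonzero common difference) of length at least exp(−C·⌞α⌟^2)·N^{c/⌞α⌟^7}. -/

import Mathlib

open Finset Pointwise

noncomputable section

/-- `lo δ = log (2/δ)`. -/
def lo (δ : ℝ) : ℝ := Real.log (2 / δ)

set_option linter.unusedSectionVars false
set_option linter.deprecated false

/-- A Bohr-type seminorm of rank `d` on a finite abelian group. -/
structure Boh {G : Type} [AddCommGroup G] (nu : G → ℝ) (d : ℕ) : Prop where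
  zero : nu 0 = 0
  neg : ∀ x, nu (-x) = nu x
  add : ∀ x y, nu (x + y) ≤ nu x + nu y
  cover : ∀ s : ℝ, 0 < s → ∃ (ι : Type) (_ : Fintype ι) (c : G → ι),
    Fintype.card ι ≤ 100 ^ d ∧
    ∀ x y, nu x ≤ 2 * s → nu y ≤ 2 * s → c x = c y → nu (x - y) ≤ s

section basic
variable {G : Type} [AddCommGroup G] [Fintype G] [DecidableEq G]

/-- The ball of a seminorm. -/
def bl (nu : G → ℝ) (s : ℝ) : Finset G := by
  classical exact Finset.univ.filter (fun x => nu x ≤ s)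

lemma mem_bl {nu : G → ℝ} {s : ℝ} {x : G} : x ∈ bl nu s ↔ nu x ≤ s := by
  simp [bl]

lemma bl_mono {nu : G → ℝ} {s t : ℝ} (h : s ≤ t) : bl nu s ⊆ bl nu t := by
  intro x hx
  rw [mem_bl] at *
  linarith

lemma Boh.nonneg {nu : G → ℝ} {d : ℕ} (h : Boh nu d) (x : G) : 0 ≤ nu x := by
  have h1 := h.add x (-x)
  rw [h.neg, add_neg_cancel, h.zero] at h1
  linarith

lemma Boh.sub {nu : G → ℝ} {d : ℕ} (h : Boh nu d) (x y : G) : nu (x - y) ≤ nu x + nu y := by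
  have h1 := h.add x (-y)
  rw [h.neg, ← sub_eq_add_neg] at h1
  linarith

lemma Boh.sum_le {nu : G → ℝ} {d : ℕ} (h : Boh nu d) {ι : Type} (s : Finset ι) (f : ι → G)
    (r : ℝ) (hr : ∀ i ∈ s, nu (f i) ≤ r) : nu (∑ i ∈ s, f i) ≤ s.card * r := by
  classical
  induction s using Finset.induction_on with
  | empty => simp [h.zero]
  | insert a s ha ih =>
    rw [Finset.sum_insert ha, Finset.card_insert_of_notMem ha]
    have h1 := h.add (f a) (∑ i ∈ s, f i)
    have h2 := hr a (Finset.mem_insert_self _ _)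
    have h3 := ih (fun i hi => hr i (Finset.mem_insert_of_mem hi))
    push_cast
    linarith

lemma Boh.zero_mem {nu : G → ℝ} {d : ℕ} (h : Boh nu d) {s : ℝ} (hs : 0 ≤ s) : (0 : G) ∈ bl nu s := by
  rw [mem_bl, h.zero]; exact hs

lemma Boh.card_pos {nu : G → ℝ} {d : ℕ} (h : Boh nu d) {s : ℝ} (hs : 0 ≤ s) :
    0 < ((bl nu s).card : ℝ) := by
  exact_mod_cast Finset.card_pos.mpr ⟨0, h.zero_mem hs⟩

lemma Boh.doubling {nu : G → ℝ} {d : ℕ} (h : Boh nu d) {s : ℝ} (hs : 0 < s) :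
    (bl nu (2 * s)).card ≤ 100 ^ d * (bl nu s).card := by
  classical
  obtain ⟨ι, _, c, hc, hcov⟩ := h.cover s hs
  have h1 : (bl nu (2 * s)).card ≤ (bl nu s).card * (Finset.univ : Finset ι).card := by
    apply Finset.card_le_mul_card_image_of_maps_to (f := c) (fun _ _ => Finset.mem_univ _)
    intro b _
    rcases Finset.eq_empty_or_nonempty ({x ∈ bl nu (2 * s) | c x = b}) with he | ⟨y, hy⟩
    · rw [he]; simp
    · apply Finset.card_le_card_of_injOn (fun x => x - y)
      · intro x hx
        simp only [Finset.coe_filter, Set.mem_setOf_eq, Finset.mem_filter, mem_bl] at hx hy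
        simp only [Finset.mem_coe, mem_bl]
        exact hcov x y hx.1 hy.1 (hx.2.trans hy.2.symm)
      · intro x _ z _ hxz
        simpa using hxz
  calc _ ≤ _ := h1
    _ ≤ (bl nu s).card * 100 ^ d := by
        apply Nat.mul_le_mul_left; simpa using hc
    _ = _ := mul_comm _ _

lemma Boh.doubling_iter {nu : G → ℝ} {d : ℕ} (h : Boh nu d) {s : ℝ} (hs : 0 < s) (k : ℕ) :
    (bl nu (2 ^ k * s)).card ≤ 100 ^ (d * k) * (bl nu s).card := by
  induction k with
  | zero => simp
  | succ k ih =>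
    have h1 := h.doubling (s := 2 ^ k * s) (by positivity)
    have h2 : (2 : ℝ) ^ (k + 1) * s = 2 * (2 ^ k * s) := by ring
    rw [h2]
    calc _ ≤ _ := h1
      _ ≤ 100 ^ d * (100 ^ (d * k) * (bl nu s).card) := Nat.mul_le_mul_left _ ih
      _ = _ := by rw [← mul_assoc, ← pow_add]; congr 2; ring

/-- Existence of regular scales. -/
lemma Boh.reg {nu : G → ℝ} {d : ℕ} (h : Boh nu d) {D m : ℕ} {eta : ℝ} (hdD : d ≤ D) (hD : 0 < D)
    (heta : 0 < eta) (hm : 99 ≤ m * eta) {u : ℝ} (hu : 0 < u) :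
    ∃ s, u / 2 ≤ s ∧ s ≤ u ∧ 0 ≤ s - 1 / (4 * m * D) * u ∧
      ((bl nu (s + 1 / (4 * m * D) * u)).card : ℝ) ≤
        (1 + eta) * (bl nu (s - 1 / (4 * m * D) * u)).card := by
  have hm0 : 0 < (m : ℝ) := by
    by_contra hcon
    have : (m : ℝ) = 0 := le_antisymm (not_lt.mp hcon) (Nat.cast_nonneg m)
    rw [this] at hm; linarith
  have hD0 : 0 < (D : ℝ) := by exact_mod_cast hD
  set n := m * D with hn
  have hn0 : 0 < (n : ℝ) := by rw [hn]; push_cast; positivity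
  set kap : ℝ := 1 / (4 * m * D) * u with hkap
  have hkap0 : 0 < kap := by positivity
  have hkn : 4 * n * kap = u := by
    rw [hkap, hn]; push_cast; field_simp
  by_contra hcon
  push Not at hcon
  have key : ∀ i : ℕ, i ≤ n → (1 + eta) ^ i * ((bl nu (u / 2)).card : ℝ) ≤
      (bl nu (u / 2 + 2 * i * kap)).card := by
    intro i
    induction i with
    | zero => intro _; simp
    | succ i ih =>
      intro hi
      have h1 := ih (by omega)
      have hi' : ((i : ℝ) + 1) ≤ n := by exact_mod_cast hi
      have h2 := hcon (u / 2 + (2 * i + 1) * kap) (by nlinarith [Nat.cast_nonneg (α := ℝ) i])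
        (by nlinarith) (by nlinarith [Nat.cast_nonneg (α := ℝ) i])
      have e1 : u / 2 + (2 * i + 1) * kap + kap = u / 2 + 2 * ((i + 1 : ℕ) : ℝ) * kap := by
        push_cast; ring
      have e2 : u / 2 + (2 * i + 1) * kap - kap = u / 2 + 2 * (i : ℝ) * kap := by
        ring
      rw [e1, e2] at h2
      have h3 : (1 + eta) ^ (i + 1) * ((bl nu (u / 2)).card : ℝ) ≤
          (1 + eta) * (bl nu (u / 2 + 2 * i * kap)).card := by
        rw [pow_succ', mul_assoc]
        exact mul_le_mul_of_nonneg_left h1 (by linarith)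
      linarith
  -- strictness from the last step
  have hn1 : 0 < n := by exact_mod_cast hn0
  obtain ⟨n', hn'⟩ : ∃ n', n = n' + 1 := ⟨n - 1, by omega⟩
  have h1 := key n' (by omega)
  have hi' : ((n' : ℝ) + 1) = n := by rw [hn']; push_cast; ring
  have h2 := hcon (u / 2 + (2 * n' + 1) * kap) (by nlinarith [Nat.cast_nonneg (α := ℝ) n'])
        (by nlinarith) (by nlinarith [Nat.cast_nonneg (α := ℝ) n'])
  have e1 : u / 2 + (2 * n' + 1) * kap + kap = u := by
    have : (n' : ℝ) = n - 1 := by linarith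
    rw [this]; linarith
  have e2 : u / 2 + (2 * n' + 1) * kap - kap = u / 2 + 2 * (n' : ℝ) * kap := by
    ring
  rw [e1, e2] at h2
  have h3 : (1 + eta) ^ n * ((bl nu (u / 2)).card : ℝ) < (bl nu u).card := by
    rw [hn', pow_succ', mul_assoc]
    refine lt_of_le_of_lt ?_ h2
    exact mul_le_mul_of_nonneg_left h1 (by linarith)
  have h4 : ((bl nu u).card : ℝ) ≤ 100 ^ d * (bl nu (u / 2)).card := by
    have := h.doubling (s := u / 2) (by positivity)
    rw [mul_div_cancel₀ u (two_ne_zero)] at this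
    exact_mod_cast this
  have h5 : (100 : ℝ) ^ d ≤ (1 + eta) ^ n := by
    calc (100 : ℝ) ^ d ≤ 100 ^ D := pow_le_pow_right₀ (by norm_num) hdD
      _ ≤ ((1 + eta) ^ m) ^ D := by
          apply pow_le_pow_left₀ (by norm_num)
          have := one_add_mul_le_pow (a := eta) (by linarith) m
          linarith
      _ = (1 + eta) ^ n := by rw [hn, pow_mul]
  have h6 := mul_le_mul_of_nonneg_right h5 (Nat.cast_nonneg (α := ℝ) (bl nu (u / 2)).card)
  linarith

end basic

section sift
variable {G : Type} [AddCommGroup G] [Fintype G] [DecidableEq G]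

/-- Correlation of a function with itself. -/
def cor (f : G → ℝ) (x : G) : ℝ := ∑ y, f y * f (x + y)
/-- Convolution of a function with itself. -/
def cnv (f : G → ℝ) (x : G) : ℝ := ∑ y, f y * f (x - y)

lemma cor_sub (f : G → ℝ) (b c : G) : cor f (b - c) = ∑ y, f (y + c) * f (y + b) := by
  unfold cor
  rw [← Equiv.sum_comp (Equiv.addRight c)]
  apply Finset.sum_congr rfl
  intro y _
  simp only [Equiv.coe_addRight]
  congr 2
  abel

lemma cor_pow (f : G → ℝ) (b c : G) (P : ℕ) :
    cor f (b - c) ^ P = ∑ z : Fin P → G, (∏ i, f (z i + c)) * ∏ i, f (z i + b) := by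
  rw [cor_sub, Fintype.sum_pow]
  simp_rw [Finset.prod_mul_distrib]

lemma cnv_pow (f : G → ℝ) (y b c : G) (P : ℕ) :
    cnv f (y + b - c) ^ P = ∑ z : Fin P → G, (∏ i, f (z i - c)) * ∏ i, f (y + b - z i) := by
  have : cnv f (y + b - c) = ∑ u, f (u - c) * f (y + b - u) := by
    unfold cnv
    rw [← Equiv.sum_comp (Equiv.subRight c)]
    apply Finset.sum_congr rfl
    intro u _
    simp only [Equiv.subRight_apply]
    congr 2
    abel
  rw [this, Fintype.sum_pow]
  simp_rw [Finset.prod_mul_distrib]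

lemma sum3_comm {α β γ : Type*} (B : Finset α) (C : Finset β) (Z : Finset γ) (F : α → β → γ → ℝ) :
    ∑ b ∈ B, ∑ c ∈ C, ∑ z ∈ Z, F b c z = ∑ z ∈ Z, ∑ b ∈ B, ∑ c ∈ C, F b c z := by
  rw [Finset.sum_comm]
  apply Eq.trans _ Finset.sum_comm
  rw [Finset.sum_comm]
  exact Finset.sum_congr rfl (fun b _ => Finset.sum_comm)

/-- The basic square expansion. -/
lemma sum_cor_pow (f : G → ℝ) (B : Finset G) (P : ℕ) :
    ∑ b ∈ B, ∑ c ∈ B, cor f (b - c) ^ P = ∑ z : Fin P → G, (∑ b ∈ B, ∏ i, f (z i + b)) ^ 2 := by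
  simp_rw [cor_pow]
  have : ∀ z : Fin P → G, (∑ b ∈ B, ∏ i, f (z i + b)) ^ 2 =
      ∑ b ∈ B, ∑ c ∈ B, (∏ i, f (z i + c)) * ∏ i, f (z i + b) := by
    intro z
    rw [sq, Finset.sum_mul_sum, Finset.sum_comm]
  simp_rw [this]
  rw [sum3_comm]

lemma sum_cor_pow_nonneg (f : G → ℝ) (B : Finset G) (P : ℕ) :
    0 ≤ ∑ b ∈ B, ∑ c ∈ B, cor f (b - c) ^ P := by
  rw [sum_cor_pow]
  positivity

lemma sum_cnv_pow_le (f : G → ℝ) (B : Finset G) (hB : ∀ x ∈ B, -x ∈ B) (y : G) (P : ℕ) :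
    ∑ b ∈ B, ∑ c ∈ B, cnv f (y + b - c) ^ P ≤ ∑ b ∈ B, ∑ c ∈ B, cor f (b - c) ^ P := by
  have h1 : ∑ b ∈ B, ∑ c ∈ B, cnv f (y + b - c) ^ P =
      ∑ z : Fin P → G, (∑ c ∈ B, ∏ i, f (z i - c)) * (∑ b ∈ B, ∏ i, f (y + b - z i)) := by
    simp_rw [cnv_pow, Finset.sum_mul_sum]
    rw [sum3_comm]
    exact Finset.sum_congr rfl (fun z _ => Finset.sum_comm)
  have h2 : ∑ z : Fin P → G, (∑ c ∈ B, ∏ i, f (z i - c)) ^ 2 =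
      ∑ b ∈ B, ∑ c ∈ B, cor f (b - c) ^ P := by
    rw [sum_cor_pow]
    apply Finset.sum_congr rfl
    intro z _
    congr 1
    apply Finset.sum_bij' (fun c _ => -c) (fun c _ => -c)
    · intro c _; simp
    · intro c _; simp
    · intro c _; simp [sub_eq_add_neg]
    · intro c hc; exact hB c hc
    · intro c hc; exact hB c hc
  have h3 : ∑ z : Fin P → G, (∑ b ∈ B, ∏ i, f (y + b - z i)) ^ 2 =
      ∑ b ∈ B, ∑ c ∈ B, cor f (b - c) ^ P := by
    rw [sum_cor_pow, ← Equiv.sum_comp (Equiv.subLeft (fun _ : Fin P => y))]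
    apply Finset.sum_congr rfl
    intro z _
    congr 1
    apply Finset.sum_congr rfl
    intro b _
    apply Finset.prod_congr rfl
    intro i _
    congr 1
    simp only [Equiv.subLeft_apply, Pi.sub_apply]
    abel
  rw [h1]
  have h4 : ∑ z : Fin P → G, (∑ c ∈ B, ∏ i, f (z i - c)) * (∑ b ∈ B, ∏ i, f (y + b - z i)) ≤
      ∑ z : Fin P → G, ((∑ c ∈ B, ∏ i, f (z i - c)) ^ 2 + (∑ b ∈ B, ∏ i, f (y + b - z i)) ^ 2) / 2 := by
    apply Finset.sum_le_sum
    intro z _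
    nlinarith [sq_nonneg ((∑ c ∈ B, ∏ i, f (z i - c)) - (∑ b ∈ B, ∏ i, f (y + b - z i)))]
  rw [← Finset.sum_div, Finset.sum_add_distrib, h2, h3] at h4
  linarith

lemma six_pow_le_choose (p : ℕ) : 6 ^ p ≤ (6 * p).choose p := by
  induction p with
  | zero => simp
  | succ p ih =>
    rw [show 6 * (p + 1) = 6 + 6 * p by ring, Nat.add_choose_eq]
    have : ((1, p) : ℕ × ℕ) ∈ Finset.HasAntidiagonal.antidiagonal (p + 1) := by simp [add_comm]
    calc 6 ^ (p + 1) = 6 * 6 ^ p := by ring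
      _ ≤ 6 * (6 * p).choose p := Nat.mul_le_mul_left _ ih
      _ = Nat.choose 6 1 * (6 * p).choose p := by simp
      _ ≤ _ := Finset.single_le_sum (f := fun ij : ℕ × ℕ => Nat.choose 6 ij.1 * (6 * p).choose ij.2)
          (fun _ _ => Nat.zero_le _) this

/-- Unbalancing. -/
lemma unbalance (f : G → ℝ) (W : ℝ) (hW : 0 < W) (B : Finset G) (p : ℕ) :
    6 ^ p * ∑ b ∈ B, ∑ c ∈ B, (cor f (b - c) / W) ^ p ≤
      ∑ b ∈ B, ∑ c ∈ B, (1 + cor f (b - c) / W) ^ (6 * p) := by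
  have hnn : ∀ k : ℕ, 0 ≤ ∑ b ∈ B, ∑ c ∈ B, (cor f (b - c) / W) ^ k := by
    intro k
    simp_rw [div_pow, ← Finset.sum_div]
    have := sum_cor_pow_nonneg f B k
    positivity
  have h1 : ∀ x : ℝ, (1 + x) ^ (6 * p) = ∑ k ∈ range (6 * p + 1), ((6 * p).choose k : ℝ) * x ^ k := by
    intro x
    rw [add_comm, add_pow]
    apply Finset.sum_congr rfl
    intro k _
    simp [mul_comm]
  simp_rw [h1]
  have h2 : ∑ b ∈ B, ∑ c ∈ B, ∑ k ∈ range (6 * p + 1), ((6 * p).choose k : ℝ) * (cor f (b - c) / W) ^ k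
      = ∑ k ∈ range (6 * p + 1), ((6 * p).choose k : ℝ) * ∑ b ∈ B, ∑ c ∈ B, (cor f (b - c) / W) ^ k := by
    simp_rw [Finset.mul_sum]
    rw [sum3_comm]
  rw [h2]
  calc _ ≤ ((6 * p).choose p : ℝ) * ∑ b ∈ B, ∑ c ∈ B, (cor f (b - c) / W) ^ p := by
        apply mul_le_mul_of_nonneg_right _ (hnn p)
        exact_mod_cast six_pow_le_choose p
    _ ≤ _ := Finset.single_le_sum
        (f := fun k => ((6 * p).choose k : ℝ) * ∑ b ∈ B, ∑ c ∈ B, (cor f (b - c) / W) ^ k)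
        (fun k _ => mul_nonneg (Nat.cast_nonneg _) (hnn k)) (by simp; omega)

/-- Indicator function. -/
def ind (A : Finset G) (x : G) : ℝ := if x ∈ A then 1 else 0

lemma ind_nonneg (A : Finset G) (x : G) : 0 ≤ ind A x := by
  unfold ind; split_ifs <;> norm_num

lemma sum_ind (A : Finset G) : ∑ x, ind A x = A.card := by
  simp [ind]

lemma sum_ind_add (A : Finset G) (b : G) : ∑ x, ind A (x + b) = A.card := by
  rw [← sum_ind, ← Equiv.sum_comp (Equiv.addRight b) (ind A)]; rfl

lemma prod_ind {P : ℕ} (A : Finset G) (z : Fin P → G) (b : G) :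
    ∏ i, ind A (z i + b) = if (∀ i, z i + b ∈ A) then 1 else 0 := by
  unfold ind
  split_ifs with h
  · exact Finset.prod_eq_one (fun i _ => by simp [h i])
  · push Not at h
    obtain ⟨i, hi⟩ := h
    exact Finset.prod_eq_zero (Finset.mem_univ i) (by simp [hi])

/-- Sifting: dependent random choice. -/
lemma sifting (A B : Finset G) (P : ℕ) (th th' eps del : ℝ) (hth : 0 ≤ th) (hth' : 0 < th')
    (hB : B.Nonempty) (heps : 0 < eps) (heps1 : eps ≤ 1) (hdel : 0 ≤ del)
    (hbig : th' ^ P * (B.card : ℝ) ^ 2 ≤ ∑ b ∈ B, ∑ c ∈ B, cor (ind A) (b - c) ^ P)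
    (h1 : th ^ P ≤ eps / 4 * th' ^ P) (h2 : del * (A.card : ℝ) ^ P ≤ eps / 4 * th' ^ P) :
    ∃ A' ⊆ B, A'.Nonempty ∧ del * B.card ≤ A'.card ∧
      ∑ b ∈ A', ∑ c ∈ A', (if cor (ind A) (b - c) < th then (1 : ℝ) else 0) ≤
        eps * (A'.card : ℝ) ^ 2 := by
  classical
  set Az : (Fin P → G) → Finset G := fun z => B.filter (fun b => ∀ i, z i + b ∈ A) with hAz
  have hcard : ∀ z, ∑ b ∈ B, ∏ i, ind A (z i + b) = (Az z).card := by
    intro z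
    simp_rw [prod_ind]
    rw [Finset.sum_boole]
  have hU : ∑ b ∈ B, ∑ c ∈ B, cor (ind A) (b - c) ^ P = ∑ z : Fin P → G, ((Az z).card : ℝ) ^ 2 := by
    rw [sum_cor_pow]
    simp_rw [hcard]
  have hBc : (0 : ℝ) < B.card := by exact_mod_cast Finset.card_pos.mpr hB
  set U := ∑ z : Fin P → G, ((Az z).card : ℝ) ^ 2 with hUdef
  have hU0 : 0 < U := by
    rw [hU] at hbig
    have : 0 < th' ^ P * (B.card : ℝ) ^ 2 := by positivity
    linarith
  have hcor : ∀ x, 0 ≤ cor (ind A) x := fun x =>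
    Finset.sum_nonneg (fun y _ => mul_nonneg (ind_nonneg _ _) (ind_nonneg _ _))
  -- bad pairs
  set bad : (Fin P → G) → ℝ := fun z => ∑ b ∈ Az z, ∑ c ∈ Az z,
    (if cor (ind A) (b - c) < th then (1 : ℝ) else 0) with hbad
  have hbadsum : ∑ z, bad z ≤ eps / 4 * U := by
    have e1 : ∑ z, bad z = ∑ b ∈ B, ∑ c ∈ B,
        (if cor (ind A) (b - c) < th then (1 : ℝ) else 0) * cor (ind A) (b - c) ^ P := by
      have : ∀ z, bad z = ∑ b ∈ B, ∑ c ∈ B, (if cor (ind A) (b - c) < th then (1 : ℝ) else 0) *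
          ((∏ i, ind A (z i + c)) * ∏ i, ind A (z i + b)) := by
        intro z
        simp only [hbad, hAz]
        rw [Finset.sum_filter]
        apply Finset.sum_congr rfl
        intro b _
        rw [Finset.sum_filter]
        rw [prod_ind A z b]
        by_cases hb : ∀ i, z i + b ∈ A
        · rw [if_pos hb]
          apply Finset.sum_congr rfl
          intro c _
          rw [prod_ind, if_pos hb]
          by_cases hc : ∀ i, z i + c ∈ A
          · rw [if_pos hc, if_pos hc]; simp
          · rw [if_neg hc, if_neg hc]; simp
        · rw [if_neg hb, if_neg hb]
          simp
      simp_rw [this, cor_pow, Finset.mul_sum]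
      rw [Finset.sum_comm]
      apply Finset.sum_congr rfl
      intro b _
      rw [Finset.sum_comm]
    rw [e1]
    calc _ ≤ ∑ b ∈ B, ∑ c ∈ B, th ^ P := by
          apply Finset.sum_le_sum; intro b _
          apply Finset.sum_le_sum; intro c _
          split_ifs with h
          · rw [one_mul]
            exact pow_le_pow_left₀ (hcor _) h.le P
          · rw [zero_mul]; positivity
      _ = th ^ P * (B.card : ℝ) ^ 2 := by simp; ring
      _ ≤ eps / 4 * th' ^ P * (B.card : ℝ) ^ 2 := mul_le_mul_of_nonneg_right h1 (by positivity)
      _ ≤ eps / 4 * U := by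
          rw [mul_assoc]
          apply mul_le_mul_of_nonneg_left _ (by positivity)
          rw [← hU]; exact hbig
  set sm : (Fin P → G) → ℝ := fun z => if ((Az z).card : ℝ) < del * B.card then ((Az z).card : ℝ) ^ 2 else 0
    with hsm
  have hsmsum : ∑ z, sm z ≤ eps / 4 * U := by
    calc ∑ z, sm z ≤ ∑ z, del * B.card * (Az z).card := by
          apply Finset.sum_le_sum; intro z _
          simp only [hsm]
          split_ifs with h
          · rw [sq]; exact mul_le_mul_of_nonneg_right h.le (Nat.cast_nonneg _)
          · positivity
      _ = del * B.card * ∑ z, ((Az z).card : ℝ) := by rw [Finset.mul_sum]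
      _ = del * B.card * (B.card * (A.card : ℝ) ^ P) := by
          congr 1
          simp_rw [← hcard]
          rw [Finset.sum_comm]
          have : ∀ b ∈ B, ∑ z : Fin P → G, ∏ i, ind A (z i + b) = (A.card : ℝ) ^ P := by
            intro b _
            rw [← sum_ind_add A b, Fintype.sum_pow]
          rw [Finset.sum_congr rfl this]; simp
      _ = del * (A.card : ℝ) ^ P * (B.card : ℝ) ^ 2 := by ring
      _ ≤ eps / 4 * th' ^ P * (B.card : ℝ) ^ 2 := mul_le_mul_of_nonneg_right h2 (by positivity)
      _ ≤ eps / 4 * U := by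
          rw [mul_assoc]
          apply mul_le_mul_of_nonneg_left _ (by positivity)
          rw [← hU]; exact hbig
  have hex : ∃ z, bad z + sm z < eps * ((Az z).card : ℝ) ^ 2 := by
    by_contra hcon
    push Not at hcon
    have := Finset.sum_le_sum (fun z (_ : z ∈ (Finset.univ : Finset (Fin P → G))) => hcon z)
    rw [← Finset.mul_sum, Finset.sum_add_distrib] at this
    nlinarith
  obtain ⟨z, hz⟩ := hex
  have hbad0 : 0 ≤ bad z := Finset.sum_nonneg (fun b _ => Finset.sum_nonneg (fun c _ => by
    split_ifs <;> norm_num))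
  have hsm0 : 0 ≤ sm z := by simp only [hsm]; split_ifs <;> positivity
  have hns : ¬ (((Az z).card : ℝ) < del * B.card) := by
    intro h
    simp only [hsm, if_pos h] at hz
    nlinarith [sq_nonneg ((Az z).card : ℝ)]
  refine ⟨Az z, Finset.filter_subset _ _, ?_, not_lt.mp hns, ?_⟩
  · rw [Finset.nonempty_iff_ne_empty]
    intro he
    rw [he] at hz
    simp at hz
    linarith
  · change bad z ≤ _
    linarith

end sift

section cs
variable {G : Type} [AddCommGroup G] [Fintype G] [DecidableEq G]

lemma exp_le_cosh_add (l y : ℝ) (h1 : -1 ≤ y) (h2 : y ≤ 1) :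
    Real.exp (l * y) ≤ Real.cosh l + y * Real.sinh l := by
  have hc := convexOn_exp
  have ha : (0 : ℝ) ≤ (1 + y) / 2 := by linarith
  have hb : (0 : ℝ) ≤ (1 - y) / 2 := by linarith
  have := hc.2 (Set.mem_univ l) (Set.mem_univ (-l)) ha hb (by ring)
  simp only [smul_eq_mul] at this
  rw [show (1 + y) / 2 * l + (1 - y) / 2 * -l = l * y by ring] at this
  rw [Real.cosh_eq, Real.sinh_eq]
  linarith

/-- One-sided Hoeffding tail bound by counting tuples. -/
lemma tail_one (A : Finset G) (phi : G → ℝ) (hA : A.Nonempty) (hphi : ∀ a ∈ A, |phi a| ≤ 1)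
    (hsum : ∑ a ∈ A, phi a = 0) (k : ℕ) (eps : ℝ) (heps : 0 ≤ eps) :
    (((Fintype.piFinset (fun _ : Fin k => A)).filter
      (fun a => k * eps < ∑ i, phi (a i))).card : ℝ) ≤
      Real.exp (-(k * eps ^ 2 / 2)) * (A.card : ℝ) ^ k := by
  have h1 : ∑ a ∈ A, Real.exp (eps * phi a) ≤ A.card * Real.exp (eps ^ 2 / 2) := by
    calc ∑ a ∈ A, Real.exp (eps * phi a) ≤ ∑ a ∈ A, (Real.cosh eps + phi a * Real.sinh eps) := by
          apply Finset.sum_le_sum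
          intro a ha
          have := abs_le.mp (hphi a ha)
          exact exp_le_cosh_add _ _ this.1 this.2
      _ = A.card * Real.cosh eps := by
          rw [Finset.sum_add_distrib, ← Finset.sum_mul, hsum]; simp
      _ ≤ _ := mul_le_mul_of_nonneg_left (Real.cosh_le_exp_half_sq eps) (Nat.cast_nonneg _)
  have h2 : ∑ a ∈ Fintype.piFinset (fun _ : Fin k => A), Real.exp (eps * ∑ i, phi (a i)) ≤
      (A.card * Real.exp (eps ^ 2 / 2)) ^ k := by
    have : ∑ a ∈ Fintype.piFinset (fun _ : Fin k => A), Real.exp (eps * ∑ i, phi (a i)) =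
        (∑ a ∈ A, Real.exp (eps * phi a)) ^ k := by
      rw [Finset.sum_pow']
      apply Finset.sum_congr rfl
      intro a _
      rw [Finset.mul_sum, Real.exp_sum]
    rw [this]
    exact pow_le_pow_left₀ (Finset.sum_nonneg (fun _ _ => (Real.exp_pos _).le)) h1 k
  have h3 : Real.exp (k * eps ^ 2) * (((Fintype.piFinset (fun _ : Fin k => A)).filter
      (fun a => k * eps < ∑ i, phi (a i))).card : ℝ) ≤
      ∑ a ∈ Fintype.piFinset (fun _ : Fin k => A), Real.exp (eps * ∑ i, phi (a i)) := by
    calc _ = ∑ a ∈ ((Fintype.piFinset (fun _ : Fin k => A)).filter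
      (fun a => k * eps < ∑ i, phi (a i))), Real.exp (k * eps ^ 2) := by simp [mul_comm]
      _ ≤ ∑ a ∈ ((Fintype.piFinset (fun _ : Fin k => A)).filter
      (fun a => k * eps < ∑ i, phi (a i))), Real.exp (eps * ∑ i, phi (a i)) := by
          apply Finset.sum_le_sum
          intro a ha
          rw [Finset.mem_filter] at ha
          apply Real.exp_le_exp.mpr
          nlinarith [ha.2]
      _ ≤ _ := Finset.sum_le_sum_of_subset_of_nonneg (Finset.filter_subset _ _)
          (fun _ _ _ => (Real.exp_pos _).le)
  have h4 := h3.trans h2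
  rw [mul_pow, ← Real.exp_nat_mul] at h4
  have h5 : Real.exp (k * eps ^ 2) * (Real.exp (-(k * eps ^ 2 / 2))) = Real.exp (k * (eps ^ 2 / 2)) := by
    rw [← Real.exp_add]; congr 1; ring
  have h6 : Real.exp (k * eps ^ 2) * (((Fintype.piFinset (fun _ : Fin k => A)).filter
      (fun a => k * eps < ∑ i, phi (a i))).card : ℝ) ≤
      Real.exp (k * eps ^ 2) * (Real.exp (-(k * eps ^ 2 / 2)) * (A.card : ℝ) ^ k) := by
    rw [← mul_assoc, h5]; linarith
  exact le_of_mul_le_mul_left h6 (Real.exp_pos _)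

lemma tail_two (A : Finset G) (phi : G → ℝ) (hA : A.Nonempty) (hphi : ∀ a ∈ A, |phi a| ≤ 1)
    (hsum : ∑ a ∈ A, phi a = 0) (k : ℕ) (eps : ℝ) (heps : 0 ≤ eps) :
    (((Fintype.piFinset (fun _ : Fin k => A)).filter
      (fun a => k * eps < |∑ i, phi (a i)|)).card : ℝ) ≤
      2 * Real.exp (-(k * eps ^ 2 / 2)) * (A.card : ℝ) ^ k := by
  have h1 := tail_one A phi hA hphi hsum k eps heps
  have h2 := tail_one A (fun x => - phi x) hA (by simpa using hphi) (by simp [hsum]) k eps heps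
  have h3 : ((Fintype.piFinset (fun _ : Fin k => A)).filter
      (fun a => k * eps < |∑ i, phi (a i)|)) ⊆ ((Fintype.piFinset (fun _ : Fin k => A)).filter
      (fun a => k * eps < ∑ i, phi (a i))) ∪ ((Fintype.piFinset (fun _ : Fin k => A)).filter
      (fun a => k * eps < ∑ i, - phi (a i))) := by
    intro a ha
    rw [Finset.mem_filter] at ha
    rw [Finset.mem_union, Finset.mem_filter, Finset.mem_filter]
    rcases lt_abs.mp ha.2 with h | h
    · left; exact ⟨ha.1, h⟩
    · right; refine ⟨ha.1, ?_⟩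
      rw [Finset.sum_neg_distrib]; exact h
  have h4 := (Finset.card_le_card h3).trans (Finset.card_union_le _ _)
  have h5 : (((Fintype.piFinset (fun _ : Fin k => A)).filter
      (fun a => k * eps < |∑ i, phi (a i)|)).card : ℝ) ≤ (((Fintype.piFinset (fun _ : Fin k => A)).filter
      (fun a => k * eps < ∑ i, phi (a i))).card : ℝ) + (((Fintype.piFinset (fun _ : Fin k => A)).filter
      (fun a => k * eps < ∑ i, - phi (a i))).card : ℝ) := by exact_mod_cast h4
  linarith

/-- Croot–Sisask almost periodicity, with exceptional sets. -/
lemma croot_sisask (A B X Y : Finset G) (S : G → ℝ) (hS0 : ∀ x, 0 ≤ S x) (hS1 : ∀ x, S x ≤ 1)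
    (hA : A.Nonempty) (hBne : B.Nonempty) (hY : ∀ a ∈ A, ∀ b ∈ B, a - b ∈ Y)
    (k : ℕ) (hk : 0 < k) (eps : ℝ) (heps : 0 < eps) :
    ∃ T ⊆ B, ((A.card : ℝ) ^ k * B.card ≤ 2 * T.card * (Y.card : ℝ) ^ k) ∧ ∃ g : G → ℝ, ∀ t ∈ T,
      ((X.filter (fun x => eps < |g (x - t) - (∑ a ∈ A, S (a - x)) / A.card|)).card : ℝ) ≤
        4 * Real.exp (-(k * eps ^ 2 / 2)) * X.card := by
  classical
  have hAc : (0 : ℝ) < A.card := by exact_mod_cast Finset.card_pos.mpr hA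
  have hk' : (0 : ℝ) < k := by exact_mod_cast hk
  set h : G → ℝ := fun x => (∑ a ∈ A, S (a - x)) / A.card with hh
  set om : ℝ := Real.exp (-(k * eps ^ 2 / 2)) with hom
  have hom0 : 0 < om := Real.exp_pos _
  set bad : (Fin k → G) → Finset G := fun a =>
    X.filter (fun x => eps < |(∑ i, S (a i - x)) / k - h x|) with hbad
  set AA := Fintype.piFinset (fun _ : Fin k => A) with hAA
  have hAAc : (AA.card : ℝ) = (A.card : ℝ) ^ k := by
    rw [hAA, Fintype.card_piFinset]; simp
  have hh0 : ∀ x, 0 ≤ h x ∧ h x ≤ 1 := by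
    intro x
    constructor
    · exact div_nonneg (Finset.sum_nonneg (fun _ _ => hS0 _)) hAc.le
    · rw [div_le_one hAc]
      calc ∑ a ∈ A, S (a - x) ≤ ∑ a ∈ A, (1 : ℝ) := Finset.sum_le_sum (fun _ _ => hS1 _)
        _ = A.card := by simp
  have hpt : ∀ x, ((AA.filter (fun a => eps < |(∑ i, S (a i - x)) / k - h x|)).card : ℝ) ≤
      2 * om * (A.card : ℝ) ^ k := by
    intro x
    have := tail_two A (fun a => S (a - x) - h x) hA (by
        intro a _
        rw [abs_le]
        constructor <;> linarith [hS0 (a - x), hS1 (a - x), (hh0 x).1, (hh0 x).2]) (by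
        rw [Finset.sum_sub_distrib]
        simp only [Finset.sum_const, nsmul_eq_mul, hh]
        field_simp
        simp) k eps heps.le
    refine le_trans ?_ this
    apply Nat.cast_le.mpr
    apply Finset.card_le_card
    intro a ha
    rw [Finset.mem_filter] at ha ⊢
    refine ⟨ha.1, ?_⟩
    have e : ∑ i, (S (a i - x) - h x) = k * ((∑ i, S (a i - x)) / k - h x) := by
      rw [Finset.sum_sub_distrib]
      simp
      field_simp
    rw [e, abs_mul, abs_of_pos hk']
    exact mul_lt_mul_of_pos_left ha.2 hk'
  have htot : ∑ a ∈ AA, ((bad a).card : ℝ) ≤ 2 * om * (A.card : ℝ) ^ k * X.card := by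
    have : ∑ a ∈ AA, ((bad a).card : ℝ) =
        ∑ x ∈ X, ((AA.filter (fun a => eps < |(∑ i, S (a i - x)) / k - h x|)).card : ℝ) := by
      simp only [hbad, Finset.card_filter, Nat.cast_sum]
      rw [Finset.sum_comm]
    rw [this]
    calc _ ≤ ∑ x ∈ X, 2 * om * (A.card : ℝ) ^ k := Finset.sum_le_sum (fun x _ => hpt x)
      _ = _ := by simp; ring
  set good := AA.filter (fun a => ((bad a).card : ℝ) ≤ 4 * om * X.card) with hgood
  have hgoodc : (A.card : ℝ) ^ k ≤ 2 * good.card := by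
    have e1 : (good.card : ℝ) + ((AA.filter (fun a => ¬ ((bad a).card : ℝ) ≤ 4 * om * X.card)).card : ℝ)
        = (A.card : ℝ) ^ k := by
      rw [← hAAc, hgood]
      exact_mod_cast Finset.card_filter_add_card_filter_not _
    set ng := AA.filter (fun a => ¬ ((bad a).card : ℝ) ≤ 4 * om * X.card) with hng
    by_contra hcon
    push Not at hcon
    have e2 : (A.card : ℝ) ^ k < 2 * ng.card := by linarith
    have hngne : ng.Nonempty := by
      rw [← Finset.card_pos]
      have : (0 : ℝ) < ng.card := by
        have : (0 : ℝ) < (A.card : ℝ) ^ k := by positivity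
        linarith
      exact_mod_cast this
    have e3 : ∑ a ∈ ng, (4 * om * X.card : ℝ) < ∑ a ∈ ng, ((bad a).card : ℝ) := by
      apply Finset.sum_lt_sum_of_nonempty hngne
      intro a ha
      rw [hng, Finset.mem_filter] at ha
      exact not_le.mp ha.2
    have e4 : ∑ a ∈ ng, ((bad a).card : ℝ) ≤ ∑ a ∈ AA, ((bad a).card : ℝ) :=
      Finset.sum_le_sum_of_subset_of_nonneg (Finset.filter_subset _ _) (fun _ _ _ => Nat.cast_nonneg _)
    rw [Finset.sum_const, nsmul_eq_mul] at e3
    have e5 : 2 * om * (A.card : ℝ) ^ k * X.card ≤ 2 * om * (2 * ng.card) * X.card := by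
      gcongr
    linarith
  -- find a base tuple
  set YY := Fintype.piFinset (fun _ : Fin k => Y) with hYY
  set Tb : (Fin k → G) → Finset G := fun b => B.filter (fun t => (fun i => b i + t) ∈ good) with hTb
  have hdc : (good.card : ℝ) * B.card ≤ ∑ b ∈ YY, ((Tb b).card : ℝ) := by
    have : ∑ b ∈ YY, ((Tb b).card : ℝ) = ∑ t ∈ B, ((YY.filter (fun b => (fun i => b i + t) ∈ good)).card : ℝ) := by
      simp only [hTb, Finset.card_filter, Nat.cast_sum]
      rw [Finset.sum_comm]
    rw [this]
    calc _ = ∑ t ∈ B, (good.card : ℝ) := by simp [mul_comm]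
      _ ≤ _ := by
        apply Finset.sum_le_sum
        intro t ht
        apply Nat.cast_le.mpr
        apply Finset.card_le_card_of_injOn (fun a i => a i - t)
        · intro a ha
          simp only [Finset.mem_coe] at ha ⊢
          rw [Finset.mem_filter]
          constructor
          · rw [hYY, Fintype.mem_piFinset]
            intro i
            have ha2 := (Finset.mem_filter.mp ha).1
            rw [hAA, Fintype.mem_piFinset] at ha2
            exact hY _ (ha2 i) _ ht
          · simpa using ha
        · intro a _ b _ hab
          funext i
          have := congrFun hab i
          simpa using this
  have hex : ∃ b ∈ YY, (A.card : ℝ) ^ k * B.card ≤ 2 * (Tb b).card * (Y.card : ℝ) ^ k := by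
    · by_contra hcon
      push Not at hcon
      have hYYne : YY.Nonempty := by
        rw [hYY, Fintype.piFinset_nonempty]
        intro _
        obtain ⟨a, ha⟩ := hA
        obtain ⟨b, hb⟩ := hBne
        exact ⟨_, hY a ha b hb⟩
      have h1 : ∑ b ∈ YY, (2 * (Tb b).card * (Y.card : ℝ) ^ k) < ∑ b ∈ YY, ((A.card : ℝ) ^ k * B.card) :=
        Finset.sum_lt_sum_of_nonempty hYYne hcon
      rw [← Finset.sum_mul, ← Finset.mul_sum, Finset.sum_const, nsmul_eq_mul] at h1
      have hYYc : (YY.card : ℝ) = (Y.card : ℝ) ^ k := by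
        rw [hYY, Fintype.card_piFinset]; simp
      rw [hYYc] at h1
      have hYp : (0 : ℝ) < (Y.card : ℝ) ^ k := by
        rw [← hYYc]; exact_mod_cast Finset.card_pos.mpr hYYne
      have h2 : 2 * ∑ b ∈ YY, ((Tb b).card : ℝ) < (A.card : ℝ) ^ k * B.card := by
        rw [mul_comm] at h1
        exact lt_of_mul_lt_mul_left h1 hYp.le
      have h3 : (A.card : ℝ) ^ k * B.card ≤ 2 * good.card * B.card :=
        mul_le_mul_of_nonneg_right hgoodc (Nat.cast_nonneg _)
      linarith
  obtain ⟨b, _, hb⟩ := hex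
  refine ⟨Tb b, Finset.filter_subset _ _, hb, fun x => (∑ i, S (b i - x)) / k, ?_⟩
  intro t ht
  have ht' := (Finset.mem_filter.mp ((Finset.mem_filter.mp ht).2)).2
  refine le_trans (le_of_eq ?_) ht'
  simp only [hbad]
  congr 2
  ext x
  simp only [Finset.mem_filter, hh]
  have : ∀ i, b i - (x - t) = b i + t - x := fun i => by abel
  simp_rw [this]

end cs

section fou
variable {G : Type} [AddCommGroup G] [Fintype G] [DecidableEq G]

lemma iter_shift {nu : G → ℝ} {d : ℕ} (hnu : Boh nu d) (A T X : Finset G) (h g : G → ℝ)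
    (hh0 : ∀ x, 0 ≤ h x) (hh1 : ∀ x, h x ≤ 1) (eps E s3 s4 : ℝ) (m : ℕ) (hs4 : 0 ≤ s4)
    (hA : A ⊆ bl nu s3) (hT : T ⊆ bl nu s4) (hX : bl nu (s3 + 2 * m * s4) ⊆ X)
    (heps : 0 ≤ eps)
    (hgood : ∀ t ∈ T, ((X.filter (fun x => eps < |g (x - t) - h x|)).card : ℝ) ≤ E) :
    ∀ j ≤ m, ∀ t t' : Fin j → G, (∀ i, t i ∈ T) → (∀ i, t' i ∈ T) →
      ∑ x ∈ A, h x - j * (2 * eps * A.card + 2 * E) ≤ ∑ x ∈ A, h (x + (∑ i, t i - ∑ i, t' i)) := by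
  intro j
  induction j with
  | zero => intro _ t t' _ _; simp
  | succ j ih =>
    intro hj t t' ht ht'
    have hj1 : ((j : ℝ) + 1) ≤ m := by exact_mod_cast hj
    have h1 := ih (by omega) (fun i => t i.castSucc) (fun i => t' i.castSucc) (fun i => ht _)
      (fun i => ht' _)
    set sg := (∑ i : Fin j, t i.castSucc - ∑ i : Fin j, t' i.castSucc) with hsg
    set u := t (Fin.last j) with hu
    set u' := t' (Fin.last j) with hu'
    have e : ∑ i, t i - ∑ i, t' i = sg + (u - u') := by
      rw [Fin.sum_univ_castSucc, Fin.sum_univ_castSucc]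
      simp only [hsg, hu, hu']
      abel
    rw [e]
    have hnsg : nu sg ≤ 2 * j * s4 := by
      have a1 := hnu.sub (∑ i : Fin j, t i.castSucc) (∑ i : Fin j, t' i.castSucc)
      have a2 := hnu.sum_le Finset.univ (fun i : Fin j => t i.castSucc) s4
        (fun i _ => mem_bl.mp (hT (ht _)))
      have a3 := hnu.sum_le Finset.univ (fun i : Fin j => t' i.castSucc) s4
        (fun i _ => mem_bl.mp (hT (ht' _)))
      simp only [Finset.card_univ, Fintype.card_fin] at a2 a3
      linarith
    have huT : u ∈ T := ht _
    have huT' : u' ∈ T := ht' _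
    have hnu1 : nu u ≤ s4 := mem_bl.mp (hT huT)
    have hnu2 : nu u' ≤ s4 := mem_bl.mp (hT huT')
    have hin1 : ∀ x ∈ A, x + sg ∈ X := by
      intro x hx
      apply hX
      rw [mem_bl]
      have a1 := hnu.add x sg
      have a2 := mem_bl.mp (hA hx)
      nlinarith
    have hin2 : ∀ x ∈ A, x + (sg + (u - u')) ∈ X := by
      intro x hx
      apply hX
      rw [mem_bl]
      have a1 := hnu.add x (sg + (u - u'))
      have a3 := hnu.add sg (u - u')
      have a4 := hnu.sub u u'
      have a2 := mem_bl.mp (hA hx)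
      nlinarith
    set E1 := A.filter (fun x => eps < |g (x + sg - u') - h (x + sg)|) with hE1
    set E2 := A.filter (fun x => eps < |g (x + (sg + (u - u')) - u) - h (x + (sg + (u - u')))|) with hE2
    have hE1c : (E1.card : ℝ) ≤ E := by
      refine le_trans ?_ (hgood u' huT')
      apply Nat.cast_le.mpr
      apply Finset.card_le_card_of_injOn (fun x => x + sg)
      · intro x hx
        have hx' := Finset.mem_filter.mp (Finset.mem_coe.mp hx)
        exact Finset.mem_coe.mpr (Finset.mem_filter.mpr ⟨hin1 x hx'.1, hx'.2⟩)
      · intro x _ y _ hxy; simpa using hxy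
    have hE2c : (E2.card : ℝ) ≤ E := by
      refine le_trans ?_ (hgood u huT)
      apply Nat.cast_le.mpr
      apply Finset.card_le_card_of_injOn (fun x => x + (sg + (u - u')))
      · intro x hx
        have hx' := Finset.mem_filter.mp (Finset.mem_coe.mp hx)
        exact Finset.mem_coe.mpr (Finset.mem_filter.mpr ⟨hin2 x hx'.1, hx'.2⟩)
      · intro x _ y _ hxy; simpa using hxy
    have hpt : ∀ x ∈ A, h (x + sg) ≤ h (x + (sg + (u - u'))) + 2 * eps +
        (if x ∈ E1 then 1 else 0) + (if x ∈ E2 then 1 else 0) := by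
      intro x hx
      have b1 := hh1 (x + sg)
      have b0 := hh0 (x + (sg + (u - u')))
      by_cases h1 : x ∈ E1
      · rw [if_pos h1]
        split_ifs <;> linarith
      · by_cases h2 : x ∈ E2
        · rw [if_pos h2, if_neg h1]; linarith
        · rw [if_neg h1, if_neg h2]
          have c1 : ¬ (eps < |g (x + sg - u') - h (x + sg)|) := fun hc =>
            h1 (Finset.mem_filter.mpr ⟨hx, hc⟩)
          have c2 : ¬ (eps < |g (x + (sg + (u - u')) - u) - h (x + (sg + (u - u')))|) := fun hc =>
            h2 (Finset.mem_filter.mpr ⟨hx, hc⟩)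
          have e3 : x + (sg + (u - u')) - u = x + sg - u' := by abel
          rw [e3] at c2
          have d1 := abs_le.mp (not_lt.mp c1)
          have d2 := abs_le.mp (not_lt.mp c2)
          linarith [d1.1, d1.2, d2.1, d2.2]
    have hs := Finset.sum_le_sum hpt
    simp only [Finset.sum_add_distrib, Finset.sum_ite_mem, Finset.sum_const, nsmul_eq_mul] at hs
    have i1 : A ∩ E1 = E1 := Finset.inter_eq_right.mpr (Finset.filter_subset _ _)
    have i2 : A ∩ E2 = E2 := Finset.inter_eq_right.mpr (Finset.filter_subset _ _)
    rw [i1, i2] at hs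
    push_cast
    linarith

/-- Fourier transform of an indicator. -/
def ft (s : Finset G) (psi : AddChar G ℂ) : ℂ := ∑ x ∈ s, psi x

lemma norm_ft_le (s : Finset G) (psi : AddChar G ℂ) : ‖ft s psi‖ ≤ s.card := by
  unfold ft
  refine (norm_sum_le _ _).trans ?_
  simp

lemma ft_neg (s : Finset G) (psi : AddChar G ℂ) : ∑ x ∈ s, psi (-x) = (starRingEnd ℂ) (ft s psi) := by
  unfold ft
  rw [map_sum]
  exact Finset.sum_congr rfl (fun x _ => AddChar.map_neg_eq_conj psi x)

lemma psi_sum {ι : Type*} (psi : AddChar G ℂ) (s : Finset ι) (t : ι → G) :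
    psi (∑ i ∈ s, t i) = ∏ i ∈ s, psi (t i) := by
  classical
  induction s using Finset.induction_on with
  | empty => simp
  | insert a s ha ih => rw [Finset.sum_insert ha, Finset.prod_insert ha, AddChar.map_add_eq_mul, ih]

lemma sum_pi_psi (T : Finset G) (psi : AddChar G ℂ) (m : ℕ) :
    ∑ t ∈ Fintype.piFinset (fun _ : Fin m => T), psi (∑ i, t i) = ft T psi ^ m := by
  unfold ft
  rw [Finset.sum_pow']
  apply Finset.sum_congr rfl
  intro t _
  rw [psi_sum]

lemma sum_pi_psi_neg (T : Finset G) (psi : AddChar G ℂ) (m : ℕ) :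
    ∑ t ∈ Fintype.piFinset (fun _ : Fin m => T), psi (-∑ i, t i) = (starRingEnd ℂ) (ft T psi) ^ m := by
  rw [← map_pow, ← sum_pi_psi, map_sum]
  exact Finset.sum_congr rfl (fun x _ => AddChar.map_neg_eq_conj psi _)

lemma cor_fourier (A : Finset G) (y : G) :
    ((Fintype.card G : ℝ) * cor (ind A) y : ℂ) = ∑ psi : AddChar G ℂ, (‖ft A psi‖ ^ 2 : ℂ) * psi y := by
  have h1 : ∀ psi : AddChar G ℂ, (‖ft A psi‖ ^ 2 : ℂ) * psi y =
      ∑ a ∈ A, ∑ b ∈ A, psi (a - b + y) := by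
    intro psi
    rw [← Complex.mul_conj', ← ft_neg]
    unfold ft
    rw [Finset.sum_mul_sum, Finset.sum_mul]
    apply Finset.sum_congr rfl; intro a _
    rw [Finset.sum_mul]
    apply Finset.sum_congr rfl; intro b _
    rw [sub_eq_add_neg, AddChar.map_add_eq_mul, AddChar.map_add_eq_mul]
  simp_rw [h1]
  rw [Finset.sum_comm]
  have h2 : ∀ a ∈ A, ∑ psi : AddChar G ℂ, ∑ b ∈ A, psi (a - b + y) =
      ∑ b ∈ A, (if a - b + y = 0 then (Fintype.card G : ℂ) else 0) := by
    intro a _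
    rw [Finset.sum_comm]
    apply Finset.sum_congr rfl; intro b _
    rw [AddChar.sum_apply_eq_ite]
  rw [Finset.sum_congr rfl h2]
  have h3 : ∀ a ∈ A, ∑ b ∈ A, (if a - b + y = 0 then (Fintype.card G : ℂ) else 0) =
      (Fintype.card G : ℂ) * (ind A (y + a) : ℝ) := by
    intro a _
    have : ∀ b, (a - b + y = 0) ↔ (y + a = b) := by
      intro b
      rw [show a - b + y = (y + a) - b by abel, sub_eq_zero]
    simp_rw [this]
    rw [Finset.sum_ite_eq]
    unfold ind
    split_ifs <;> simp
  rw [Finset.sum_congr rfl h3]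
  unfold cor
  rw [← Finset.mul_sum]
  push_cast
  congr 1
  have : ∑ x : G, ((ind A x : ℝ) : ℂ) * ((ind A (y + x) : ℝ) : ℂ) =
      ∑ x : G, if x ∈ A then ((ind A (y + x) : ℝ) : ℂ) else 0 := by
    apply Finset.sum_congr rfl; intro x _
    nth_rewrite 1 [ind]
    split_ifs <;> simp
  rw [this]
  simp

lemma planch (A : Finset G) :
    ∑ psi : AddChar G ℂ, ‖ft A psi‖ ^ 2 = (Fintype.card G : ℝ) * A.card := by
  have h := cor_fourier A 0
  simp only [AddChar.map_zero_eq_one, mul_one] at h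
  have h2 : cor (ind A) 0 = A.card := by
    unfold cor
    rw [← sum_ind]
    apply Finset.sum_congr rfl; intro x _
    unfold ind
    rw [zero_add]; split_ifs <;> simp
  rw [h2] at h
  have h3 : ((∑ psi : AddChar G ℂ, ‖ft A psi‖ ^ 2 : ℝ) : ℂ) = (((Fintype.card G : ℝ) * A.card : ℝ) : ℂ) := by
    push_cast
    rw [← h]; push_cast; rfl
  exact_mod_cast h3

/-- The averaged correlation. -/
def QQ (A A' T : Finset G) (m : ℕ) (v : G) : ℝ :=
  ∑ a ∈ A', ∑ x ∈ A', ∑ t ∈ Fintype.piFinset (fun _ : Fin m => T),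
    ∑ t' ∈ Fintype.piFinset (fun _ : Fin m => T), cor (ind A) (a - (x + (∑ i, t i - ∑ i, t' i)) + v)

lemma QQ_fourier (A A' T : Finset G) (m : ℕ) (v : G) :
    (Fintype.card G : ℝ) * QQ A A' T m v =
      ∑ psi : AddChar G ℂ, ‖ft A psi‖ ^ 2 * ‖ft A' psi‖ ^ 2 * (‖ft T psi‖ ^ 2) ^ m * (psi v).re := by
  have key : ((Fintype.card G : ℝ) * QQ A A' T m v : ℂ) =
      ∑ psi : AddChar G ℂ, (((‖ft A psi‖ ^ 2 * ‖ft A' psi‖ ^ 2 * (‖ft T psi‖ ^ 2) ^ m : ℝ)) : ℂ) * psi v := by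
    unfold QQ
    push_cast
    simp_rw [Finset.mul_sum]
    have : ∀ y, ((Fintype.card G : ℂ) * (cor (ind A) y : ℂ)) =
      ∑ psi : AddChar G ℂ, (‖ft A psi‖ ^ 2 : ℂ) * psi y := by
      intro y; rw [← cor_fourier]; simp
    simp_rw [this]
    -- bring the sum over psi outside
    have sw : ∀ (F : G → G → (Fin m → G) → (Fin m → G) → AddChar G ℂ → ℂ) (S1 : Finset G)
        (S2 : Finset (Fin m → G)),
        ∑ a ∈ S1, ∑ x ∈ S1, ∑ t ∈ S2, ∑ t' ∈ S2, ∑ psi, F a x t t' psi =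
        ∑ psi, ∑ a ∈ S1, ∑ x ∈ S1, ∑ t ∈ S2, ∑ t' ∈ S2, F a x t t' psi := by
      intro F S1 S2
      rw [Finset.sum_comm (s := Finset.univ)]
      apply Finset.sum_congr rfl; intro a _
      rw [Finset.sum_comm (s := Finset.univ)]
      apply Finset.sum_congr rfl; intro x _
      rw [Finset.sum_comm (s := Finset.univ)]
      apply Finset.sum_congr rfl; intro t _
      rw [Finset.sum_comm (s := Finset.univ)]
    rw [sw]
    apply Finset.sum_congr rfl; intro psi _
    have e1 : ∀ (a x : G) (t t' : Fin m → G), psi (a - (x + (∑ i, t i - ∑ i, t' i)) + v) =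
        psi a * (psi (-x) * (psi (-∑ i, t i) * (psi (∑ i, t' i) * psi v))) := by
      intro a x t t'
      rw [← AddChar.map_add_eq_mul, ← AddChar.map_add_eq_mul, ← AddChar.map_add_eq_mul,
        ← AddChar.map_add_eq_mul]
      congr 1; abel
    simp_rw [e1, ← Finset.mul_sum, ← Finset.sum_mul]
    rw [sum_pi_psi, sum_pi_psi_neg, ft_neg]
    rw [← Complex.mul_conj' (ft A' psi), ← Complex.mul_conj' (ft T psi), mul_pow]
    change _ * (ft A' psi * _) = _
    ring
  have := congrArg Complex.re key
  rw [Complex.re_sum] at this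
  simp only [Complex.re_ofReal_mul] at this
  rw [← this]
  rw [Complex.ofReal_re]

lemma QQ_shift (A A' T : Finset G) (m : ℕ) (v : G) (e1 : ℝ) (he1 : 0 ≤ e1) (_he11 : e1 ≤ 1)
    (hv : ∀ psi : AddChar G ℂ, (T.card : ℝ) / 2 ≤ ‖ft T psi‖ → ‖1 - psi v‖ ≤ e1) :
    (1 - e1) * QQ A A' T m 0 - 2 * (A'.card : ℝ) ^ 2 * ((T.card : ℝ) ^ 2 / 4) ^ m * A.card ≤
      QQ A A' T m v := by
  have hG : (0 : ℝ) < Fintype.card G := by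
    exact_mod_cast Fintype.card_pos
  apply le_of_mul_le_mul_left _ hG
  rw [mul_sub, mul_left_comm, QQ_fourier, QQ_fourier]
  have e2 : (Fintype.card G : ℝ) * (2 * (A'.card : ℝ) ^ 2 * ((T.card : ℝ) ^ 2 / 4) ^ m * A.card) =
      ∑ psi : AddChar G ℂ, ‖ft A psi‖ ^ 2 * (2 * (A'.card : ℝ) ^ 2 * ((T.card : ℝ) ^ 2 / 4) ^ m) := by
    rw [← Finset.sum_mul, planch]; ring
  rw [e2, Finset.mul_sum, ← Finset.sum_sub_distrib]
  apply Finset.sum_le_sum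
  intro psi _
  simp only [AddChar.map_zero_eq_one, Complex.one_re, mul_one]
  set W := ‖ft A psi‖ ^ 2 with hW
  set W' := ‖ft A' psi‖ ^ 2 with hW'
  set Z := (‖ft T psi‖ ^ 2) ^ m with hZ
  have hW0 : 0 ≤ W := by positivity
  have hW'0 : 0 ≤ W' := by positivity
  have hZ0 : 0 ≤ Z := by positivity
  have hre : |(psi v).re| ≤ 1 := by
    refine (Complex.abs_re_le_norm _).trans ?_
    simp
  have hre1 := (abs_le.mp hre).1
  by_cases hc : (T.card : ℝ) / 2 ≤ ‖ft T psi‖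
  · have h1 := hv psi hc
    have h2 : 1 - (psi v).re ≤ e1 := by
      have := (Complex.re_le_norm (1 - psi v)).trans h1
      simpa using this
    have h3 : 0 ≤ W * (2 * (A'.card : ℝ) ^ 2 * ((T.card : ℝ) ^ 2 / 4) ^ m) := by positivity
    have h4 : 0 ≤ W * W' * Z * ((psi v).re - (1 - e1)) := by
      apply mul_nonneg (by positivity); linarith
    nlinarith
  · push Not at hc
    have h1 : Z ≤ ((T.card : ℝ) ^ 2 / 4) ^ m := by
      rw [hZ]
      apply pow_le_pow_left₀ (by positivity)
      have := norm_nonneg (ft T psi)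
      nlinarith
    have h2 : W' ≤ (A'.card : ℝ) ^ 2 := by
      rw [hW']
      exact pow_le_pow_left₀ (norm_nonneg _) (norm_ft_le _ _) 2
    have h3 : W * W' * Z ≤ W * ((A'.card : ℝ) ^ 2 * ((T.card : ℝ) ^ 2 / 4) ^ m) := by
      rw [mul_assoc]
      apply mul_le_mul_of_nonneg_left _ hW0
      exact mul_le_mul h2 h1 hZ0 (by positivity)
    have h4 : 0 ≤ W * W' * Z := by positivity
    nlinarith [mul_nonneg h4 he1, mul_nonneg h4 (by linarith : 0 ≤ (psi v).re + 1)]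

/-- Upper bound by the maximal density on translates. -/
lemma QQ_upper (A A' T V : Finset G) (m : ℕ) (M : ℝ)
    (hM : ∀ x, ((V.filter (fun v => x + v ∈ A)).card : ℝ) ≤ M) :
    ∑ v ∈ V, QQ A A' T m v ≤ (A'.card : ℝ) ^ 2 * ((T.card : ℝ) ^ m) ^ 2 * (A.card * M) := by
  have hc : ∀ y, ∑ v ∈ V, cor (ind A) (y + v) ≤ A.card * M := by
    intro y
    unfold cor
    rw [Finset.sum_comm]
    calc _ = ∑ u, ind A u * ((V.filter (fun v => (y + u) + v ∈ A)).card : ℝ) := by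
          apply Finset.sum_congr rfl; intro u _
          rw [← Finset.mul_sum]
          congr 1
          unfold ind
          rw [← Finset.sum_boole]
          apply Finset.sum_congr rfl; intro v _
          rw [show y + v + u = y + u + v by abel]
      _ ≤ ∑ u, ind A u * M := Finset.sum_le_sum (fun u _ =>
          mul_le_mul_of_nonneg_left (hM _) (ind_nonneg _ _))
      _ = A.card * M := by rw [← Finset.sum_mul, sum_ind]
  unfold QQ
  have sw : ∑ v ∈ V, ∑ a ∈ A', ∑ x ∈ A', ∑ t ∈ Fintype.piFinset (fun _ : Fin m => T),
      ∑ t' ∈ Fintype.piFinset (fun _ : Fin m => T), cor (ind A) (a - (x + (∑ i, t i - ∑ i, t' i)) + v) =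
      ∑ a ∈ A', ∑ x ∈ A', ∑ t ∈ Fintype.piFinset (fun _ : Fin m => T),
      ∑ t' ∈ Fintype.piFinset (fun _ : Fin m => T), ∑ v ∈ V,
        cor (ind A) (a - (x + (∑ i, t i - ∑ i, t' i)) + v) := by
    rw [Finset.sum_comm]
    apply Finset.sum_congr rfl; intro a _
    rw [Finset.sum_comm]
    apply Finset.sum_congr rfl; intro x _
    rw [Finset.sum_comm]
    apply Finset.sum_congr rfl; intro t _
    rw [Finset.sum_comm]
  rw [sw]
  calc _ ≤ ∑ a ∈ A', ∑ x ∈ A', ∑ t ∈ Fintype.piFinset (fun _ : Fin m => T),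
      ∑ t' ∈ Fintype.piFinset (fun _ : Fin m => T), (A.card * M) := by
        apply Finset.sum_le_sum; intro a _
        apply Finset.sum_le_sum; intro x _
        apply Finset.sum_le_sum; intro t _
        apply Finset.sum_le_sum; intro t' _
        exact hc _
    _ = _ := by
        simp only [Finset.sum_const, Fintype.card_piFinset, Finset.prod_const, Finset.card_univ,
          Fintype.card_fin, nsmul_eq_mul]
        push_cast
        ring
end fou

section chang
variable {G : Type} [AddCommGroup G] [Fintype G] [DecidableEq G]

/-- three exponents -/
def tri : Finset ℤ := {-1, 0, 1}

/-- product character -/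
def pch {r : ℕ} (lam : Fin r → AddChar G ℂ) (w : Fin r → ℤ) : AddChar G ℂ := ∏ i, lam i ^ (w i)

/-- dissociation -/
def Dis {r : ℕ} (lam : Fin r → AddChar G ℂ) (B : Finset G) : Prop :=
  ∀ w : Fin r → ℤ, (∀ i, w i ∈ tri) → w ≠ 0 → ‖ft B (pch lam w)‖ < (B.card : ℝ) / 2

lemma ft_inv (s : Finset G) (psi : AddChar G ℂ) : ‖ft s psi⁻¹‖ = ‖ft s psi‖ := by
  rw [← Complex.norm_conj (ft s psi), ← ft_neg]
  unfold ft
  congr 1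

lemma pch_snoc {r : ℕ} (lam : Fin r → AddChar G ℂ) (psi : AddChar G ℂ) (w : Fin (r+1) → ℤ) :
    pch (Fin.snoc lam psi : Fin (r+1) → AddChar G ℂ) w =
      pch lam (fun i => w i.castSucc) * psi ^ (w (Fin.last r)) := by
  unfold pch
  rw [Fin.prod_univ_castSucc]
  simp

lemma pch_neg {r : ℕ} (lam : Fin r → AddChar G ℂ) (w : Fin r → ℤ) :
    pch lam (fun i => - w i) = (pch lam w)⁻¹ := by
  unfold pch
  simp

lemma tri_mem {j : ℤ} : j ∈ tri ↔ j = -1 ∨ j = 0 ∨ j = 1 := by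
  unfold tri; simp

lemma tri_neg {j : ℤ} (h : j ∈ tri) : -j ∈ tri := by
  rw [tri_mem] at *; omega

lemma ext_step {r : ℕ} (lam : Fin r → AddChar G ℂ) (B : Finset G) (hd : Dis lam B)
    (psi : AddChar G ℂ) (hn : ¬ Dis (Fin.snoc lam psi : Fin (r+1) → AddChar G ℂ) B) :
    ∃ w : Fin r → ℤ, (∀ i, w i ∈ tri) ∧ (B.card : ℝ) / 2 ≤ ‖ft B (psi * pch lam w)‖ := by
  unfold Dis at hn
  push Not at hn
  obtain ⟨w, hw, hw0, hb⟩ := hn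
  rw [pch_snoc] at hb
  rcases tri_mem.mp (hw (Fin.last r)) with h | h | h
  · refine ⟨fun i => - w i.castSucc, fun i => tri_neg (hw _), ?_⟩
    rw [pch_neg, ← ft_inv]
    rw [h] at hb
    simpa [mul_comm] using hb
  · exfalso
    have hne : (fun i : Fin r => w i.castSucc) ≠ 0 := by
      intro h0
      apply hw0
      ext i
      refine Fin.lastCases ?_ ?_ i
      · simpa using h
      · intro j; simpa using congrFun h0 j
    have := hd _ (fun i => hw _) hne
    rw [h] at hb
    simp only [zpow_zero, mul_one] at hb
    linarith
  · refine ⟨fun i => w i.castSucc, fun i => hw _, ?_⟩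
    rw [h] at hb
    simpa [mul_comm] using hb

/-- Riesz coefficients -/
def rco (c : ℂ) (j : ℤ) : ℂ := if j = 0 then 1 else if j = 1 then c / 16 else (starRingEnd ℂ) c / 16

/-- Riesz product -/
def rsz {r : ℕ} (lam : Fin r → AddChar G ℂ) (c : Fin r → ℂ) (x : G) : ℝ :=
  ∏ i, (1 + (c i * lam i x).re / 8)

lemma rsz_expand {r : ℕ} (lam : Fin r → AddChar G ℂ) (c : Fin r → ℂ) (x : G) :
    (rsz lam c x : ℂ) = ∑ w ∈ Fintype.piFinset (fun _ : Fin r => tri),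
      (∏ i, rco (c i) (w i)) * pch lam w x := by
  have h1 : ∀ i, ((1 + (c i * lam i x).re / 8 : ℝ) : ℂ) =
      ∑ j ∈ tri, rco (c i) j * (lam i ^ j) x := by
    intro i
    unfold tri
    rw [Finset.sum_insert (by simp), Finset.sum_insert (by simp), Finset.sum_singleton]
    have e1 : (lam i ^ (-1 : ℤ)) x = (starRingEnd ℂ) (lam i x) := by
      rw [zpow_neg_one, AddChar.inv_apply, AddChar.map_neg_eq_conj]
    rw [e1]
    simp only [rco, zpow_zero, zpow_one, AddChar.one_apply]
    norm_num
    have := Complex.add_conj (c i * lam i x)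
    rw [map_mul] at this
    have h2 : ((c i * lam i x).re : ℂ) = (c i * lam i x + (starRingEnd ℂ) (c i) * (starRingEnd ℂ) (lam i x)) / 2 := by
      rw [this]; push_cast; ring
    have h3 : (((c i).re * (lam i x).re - (c i).im * (lam i x).im : ℝ) : ℂ) = ((c i * lam i x).re : ℂ) := by
      rw [Complex.mul_re]
    push_cast at h3
    rw [h3, h2]
    ring
  unfold rsz
  rw [Complex.ofReal_prod]
  simp_rw [h1]
  rw [Finset.prod_univ_sum]
  apply Finset.sum_congr rfl
  intro w _
  rw [Finset.prod_mul_distrib]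
  congr 1
  unfold pch
  rw [AddChar.prod_apply]

lemma rco_norm (c : ℂ) (hc : ‖c‖ ≤ 1) : ∑ j ∈ tri, ‖rco c j‖ ≤ 9 / 8 := by
  unfold tri
  rw [Finset.sum_insert (by simp), Finset.sum_insert (by simp), Finset.sum_singleton]
  simp [rco]
  linarith

lemma rsz_upper {r n : ℕ} (lam : Fin r → AddChar G ℂ) (c : Fin r → ℂ) (hc : ∀ i, ‖c i‖ ≤ 1)
    (B : Finset G) (hd : Dis lam B) (hr : r ≤ n) (z : G) :
    ∑ y ∈ Fintype.piFinset (fun _ : Fin n => B), rsz lam c (z + ∑ i, y i) ≤ 2 * (B.card : ℝ) ^ n := by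
  have e : ((∑ y ∈ Fintype.piFinset (fun _ : Fin n => B), rsz lam c (z + ∑ i, y i) : ℝ) : ℂ) =
      ∑ w ∈ Fintype.piFinset (fun _ : Fin r => tri),
      (∏ i, rco (c i) (w i)) * (pch lam w z * ft B (pch lam w) ^ n) := by
    rw [Complex.ofReal_sum]
    simp_rw [rsz_expand]
    rw [Finset.sum_comm]
    apply Finset.sum_congr rfl; intro w _
    rw [← Finset.mul_sum]
    congr 1
    rw [← sum_pi_psi, Finset.mul_sum]
    apply Finset.sum_congr rfl; intro y _
    rw [AddChar.map_add_eq_mul]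
  have h1 := Complex.re_le_norm ((∑ y ∈ Fintype.piFinset (fun _ : Fin n => B), rsz lam c (z + ∑ i, y i) : ℝ) : ℂ)
  rw [Complex.ofReal_re] at h1
  refine h1.trans ?_
  rw [e]
  refine (norm_sum_le _ _).trans ?_
  have hB : (0:ℝ) ≤ (B.card : ℝ) ^ n := by positivity
  have h2 : ∀ w ∈ Fintype.piFinset (fun _ : Fin r => tri),
      ‖(∏ i, rco (c i) (w i)) * (pch lam w z * ft B (pch lam w) ^ n)‖ ≤
      (if w = 0 then (B.card : ℝ) ^ n else 0) + (∏ i, ‖rco (c i) (w i)‖) * ((B.card : ℝ) / 2) ^ n := by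
    intro w hw
    rw [norm_mul, norm_mul, norm_prod, norm_pow, AddChar.norm_apply, one_mul]
    by_cases h0 : w = 0
    · rw [if_pos h0]
      have a1 : ∏ i, ‖rco (c i) (w i)‖ = 1 := by
        apply Finset.prod_eq_one; intro i _; simp [h0, rco]
      rw [a1, one_mul, one_mul]
      have := pow_le_pow_left₀ (norm_nonneg _) (norm_ft_le B (pch lam w)) n
      have : (0:ℝ) ≤ ((B.card : ℝ) / 2) ^ n := by positivity
      linarith
    · rw [if_neg h0, zero_add]
      apply mul_le_mul_of_nonneg_left _ (Finset.prod_nonneg (fun i _ => norm_nonneg _))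
      apply pow_le_pow_left₀ (norm_nonneg _)
      exact (hd w (fun i => Fintype.mem_piFinset.mp hw i) h0).le
  refine (Finset.sum_le_sum h2).trans ?_
  rw [Finset.sum_add_distrib, ← Finset.sum_mul]
  have h3 : ∑ w ∈ Fintype.piFinset (fun _ : Fin r => tri), (if w = 0 then (B.card : ℝ) ^ n else 0) ≤ (B.card : ℝ) ^ n := by
    rw [Finset.sum_ite_eq']
    split_ifs <;> linarith
  have h4 : ∑ w ∈ Fintype.piFinset (fun _ : Fin r => tri), ∏ i, ‖rco (c i) (w i)‖ ≤ (9/8 : ℝ) ^ n := by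
    rw [← Finset.prod_univ_sum (fun _ : Fin r => tri) (fun i j => ‖rco (c i) j‖)]
    calc _ ≤ ∏ i : Fin r, (9/8 : ℝ) := Finset.prod_le_prod
          (fun i _ => Finset.sum_nonneg (fun _ _ => norm_nonneg _)) (fun i _ => rco_norm _ (hc i))
      _ = (9/8 : ℝ) ^ r := by rw [Finset.prod_const]; simp
      _ ≤ _ := pow_le_pow_right₀ (by norm_num) hr
  have h5 : (∑ w ∈ Fintype.piFinset (fun _ : Fin r => tri), ∏ i, ‖rco (c i) (w i)‖) * ((B.card : ℝ) / 2) ^ n ≤ (B.card : ℝ) ^ n := by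
    calc _ ≤ (9/8 : ℝ) ^ n * ((B.card : ℝ) / 2) ^ n := mul_le_mul_of_nonneg_right h4 (by positivity)
      _ = ((9/16) * (B.card : ℝ)) ^ n := by rw [← mul_pow]; congr 1; ring
      _ ≤ _ := pow_le_pow_left₀ (by positivity) (by nlinarith [(Nat.cast_nonneg B.card : (0:ℝ) ≤ _)]) n
  linarith

lemma rsz_nonneg {r : ℕ} (lam : Fin r → AddChar G ℂ) (c : Fin r → ℂ) (hc : ∀ i, ‖c i‖ ≤ 1) (x : G) :
    0 ≤ rsz lam c x := by
  apply Finset.prod_nonneg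
  intro i _
  have h := Complex.abs_re_le_norm (c i * lam i x)
  rw [norm_mul, AddChar.norm_apply, mul_one] at h
  have := (abs_le.mp (h.trans (hc i))).1
  linarith

lemma rsz_lower {r : ℕ} (lam : Fin r → AddChar G ℂ) (T : Finset G)
    (hT : ∀ i, (T.card : ℝ) / 2 ≤ ‖ft T (lam i)‖) :
    ∃ c : Fin r → ℂ, (∀ i, ‖c i‖ ≤ 1) ∧ T.card * Real.exp (r / 32) ≤ ∑ x ∈ T, rsz lam c x := by
  refine ⟨fun i => (starRingEnd ℂ) (ft T (lam i)) / ‖ft T (lam i)‖, ?_, ?_⟩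
  · intro i
    rw [norm_div, Complex.norm_conj, Complex.norm_real, norm_norm]
    exact div_self_le_one _
  set c : Fin r → ℂ := fun i => (starRingEnd ℂ) (ft T (lam i)) / ‖ft T (lam i)‖ with hcdef
  have hc : ∀ i, ‖c i‖ ≤ 1 := by
    intro i
    simp only [hcdef]
    rw [norm_div, Complex.norm_conj, Complex.norm_real, norm_norm]
    exact div_self_le_one _
  have hcf : ∀ i, ∑ x ∈ T, (c i * lam i x).re = ‖ft T (lam i)‖ := by
    intro i
    rw [← Complex.re_sum, ← Finset.mul_sum]
    change (c i * ft T (lam i)).re = _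
    simp only [hcdef]
    by_cases h0 : ft T (lam i) = 0
    · simp [h0]
    · have hn : (‖ft T (lam i)‖ : ℂ) ≠ 0 := by simpa using h0
      rw [div_mul_eq_mul_div, Complex.conj_mul']
      rw [pow_two, mul_div_assoc, div_self hn, mul_one, Complex.ofReal_re]
  have hpt : ∀ x i, |(c i * lam i x).re| ≤ 1 := by
    intro x i
    have h := Complex.abs_re_le_norm (c i * lam i x)
    rw [norm_mul, AddChar.norm_apply, mul_one] at h
    exact h.trans (hc i)
  have hexp : ∀ u : ℝ, |u| ≤ 1 → Real.exp (u / 8 - 1 / 32) ≤ 1 + u / 8 := by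
    intro u hu
    have hu' := abs_le.mp hu
    have h1 := Real.abs_exp_sub_one_sub_id_le (x := u / 8 - 1 / 32) (by rw [abs_le]; constructor <;> linarith)
    have h2 := (abs_le.mp h1).2
    nlinarith
  have hP : ∀ x, Real.exp (r / 32) * (1 + (∑ i, ((c i * lam i x).re / 8 - 1 / 32)) - r / 32) ≤ rsz lam c x := by
    intro x
    set Y := ∑ i, ((c i * lam i x).re / 8 - 1 / 32) with hY
    have h1 : Real.exp Y ≤ rsz lam c x := by
      rw [hY, Real.exp_sum]
      exact Finset.prod_le_prod (fun i _ => (Real.exp_pos _).le) (fun i _ => hexp _ (hpt x i))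
    refine le_trans ?_ h1
    have h2 : Real.exp Y = Real.exp (r/32) * Real.exp (Y - r/32) := by
      rw [← Real.exp_add]; congr 1; ring
    rw [h2]
    apply mul_le_mul_of_nonneg_left _ (Real.exp_pos _).le
    have := Real.add_one_le_exp (Y - r/32)
    linarith
  have hs := Finset.sum_le_sum (fun x (_ : x ∈ T) => hP x)
  refine le_trans ?_ hs
  rw [← Finset.mul_sum, mul_comm]
  apply mul_le_mul_of_nonneg_left _ (Real.exp_pos _).le
  rw [Finset.sum_sub_distrib, Finset.sum_add_distrib, Finset.sum_comm]
  have h6 : ∀ i, (T.card : ℝ) / 32 ≤ ∑ x ∈ T, ((c i * lam i x).re / 8 - 1 / 32) := by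
    intro i
    rw [Finset.sum_sub_distrib, ← Finset.sum_div, hcf]
    have := hT i
    simp only [Finset.sum_const, nsmul_eq_mul]
    linarith
  have h7 : (r : ℝ) * ((T.card : ℝ) / 32) ≤ ∑ i, ∑ x ∈ T, ((c i * lam i x).re / 8 - 1 / 32) := by
    calc _ = ∑ i : Fin r, (T.card : ℝ) / 32 := by simp
      _ ≤ _ := Finset.sum_le_sum (fun i _ => h6 i)
  simp only [Finset.sum_const, nsmul_eq_mul, mul_one]
  linarith

lemma chang (T B4 B4p B5 : Finset G) (n : ℕ) (hTB : T ⊆ B4) (hB5 : B5.Nonempty)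
    (hinc : ∀ x ∈ B4, ∀ y : Fin n → G, (∀ i, y i ∈ B5) → x - ∑ i, y i ∈ B4p)
    (hcard : (B4p.card : ℝ) ≤ 2 * B4.card)
    (hn : 4 * (B4.card : ℝ) < T.card * Real.exp (n / 32)) :
    ∃ r, r ≤ n ∧ ∃ lam : Fin r → AddChar G ℂ, ∀ psi : AddChar G ℂ, (T.card : ℝ) / 2 ≤ ‖ft T psi‖ →
      ∃ w : Fin r → ℤ, (∀ i, w i ∈ tri) ∧ (B5.card : ℝ) / 2 ≤ ‖ft B5 (psi * pch lam w)‖ := by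
  classical
  let Q : ℕ → Prop := fun r => ∃ lam : Fin r → AddChar G ℂ,
    (∀ i, (T.card : ℝ) / 2 ≤ ‖ft T (lam i)‖) ∧ Dis lam B5
  have hQ0 : Q 0 := by
    refine ⟨Fin.elim0, fun i => i.elim0, ?_⟩
    intro w _ hw
    exact absurd (Subsingleton.elim _ _) hw
  have hQn : ¬ Q n := by
    rintro ⟨lam, h1, h2⟩
    obtain ⟨c, hc, hl⟩ := rsz_lower lam T h1
    have hb5 : (0:ℝ) < (B5.card : ℝ) ^ n := by
      have : 0 < B5.card := hB5.card_pos
      positivity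
    have hup : (B5.card : ℝ) ^ n * ∑ x ∈ T, rsz lam c x ≤ (B5.card : ℝ) ^ n * (2 * B4p.card) := by
      calc (B5.card : ℝ) ^ n * ∑ x ∈ T, rsz lam c x
          ≤ (B5.card : ℝ) ^ n * ∑ x ∈ B4, rsz lam c x := by
            apply mul_le_mul_of_nonneg_left _ hb5.le
            exact Finset.sum_le_sum_of_subset_of_nonneg hTB (fun x _ _ => rsz_nonneg lam c hc x)
        _ = ∑ y ∈ Fintype.piFinset (fun _ : Fin n => B5), ∑ x ∈ B4, rsz lam c x := by
            simp [Fintype.card_piFinset]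
        _ ≤ ∑ y ∈ Fintype.piFinset (fun _ : Fin n => B5), ∑ z ∈ B4p, rsz lam c (z + ∑ i, y i) := by
            apply Finset.sum_le_sum
            intro y hy
            have hy' := Fintype.mem_piFinset.mp hy
            calc ∑ x ∈ B4, rsz lam c x = ∑ z ∈ B4.image (fun x => x - ∑ i, y i), rsz lam c (z + ∑ i, y i) := by
                  rw [Finset.sum_image (by intro a _ b _ hab; simpa using hab)]
                  simp
              _ ≤ _ := by
                  apply Finset.sum_le_sum_of_subset_of_nonneg
                  · intro z hz
                    obtain ⟨x, hx, rfl⟩ := Finset.mem_image.mp hz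
                    exact hinc x hx y hy'
                  · intro z _ _; exact rsz_nonneg lam c hc _
        _ = ∑ z ∈ B4p, ∑ y ∈ Fintype.piFinset (fun _ : Fin n => B5), rsz lam c (z + ∑ i, y i) := Finset.sum_comm
        _ ≤ ∑ z ∈ B4p, 2 * (B5.card : ℝ) ^ n := Finset.sum_le_sum (fun z _ => rsz_upper lam c hc B5 h2 le_rfl z)
        _ = _ := by simp; ring
    have := le_of_mul_le_mul_left hup hb5
    linarith
  have hr := Nat.findGreatest_spec (P := Q) (Nat.zero_le n) hQ0
  set r := Nat.findGreatest Q n with hrdef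
  have hrn : r ≤ n := Nat.findGreatest_le n
  have hrlt : r < n := lt_of_le_of_ne hrn (by rintro h; rw [h] at hr; exact hQn hr)
  have hmax : ¬ Q (r+1) := Nat.findGreatest_is_greatest (Nat.lt_succ_self r) hrlt
  obtain ⟨lam, h1, h2⟩ := hr
  refine ⟨r, hrn, lam, ?_⟩
  intro psi hpsi
  apply ext_step lam B5 h2 psi
  intro hdis
  apply hmax
  refine ⟨Fin.snoc lam psi, ?_, hdis⟩
  intro i
  refine Fin.lastCases ?_ ?_ i
  · simpa using hpsi
  · intro j; simpa using h1 j

end chang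

section addch
variable {G : Type} [AddCommGroup G] [Fintype G] [DecidableEq G]

lemma Boh.scale {nu : G → ℝ} {d : ℕ} (h : Boh nu d) {k : ℝ} (hk : 0 < k) :
    Boh (fun x => k * nu x) d where
  zero := by simp [h.zero]
  neg x := by simp [h.neg]
  add x y := by
    have := mul_le_mul_of_nonneg_left (h.add x y) hk.le
    linarith
  cover s hs := by
    obtain ⟨ι, i1, c, h1, h2⟩ := h.cover (s / k) (by positivity)
    refine ⟨ι, i1, c, h1, ?_⟩
    intro x y hx hy hc
    have := h2 x y (by rw [← mul_div_assoc, le_div_iff₀ hk]; linarith)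
      (by rw [← mul_div_assoc, le_div_iff₀ hk]; linarith) hc
    rw [le_div_iff₀ hk] at this
    linarith

lemma Boh.max {nu mu : G → ℝ} {d e : ℕ} (h : Boh nu d) (h' : Boh mu e) :
    Boh (fun x => max (nu x) (mu x)) (d + e) where
  zero := by simp [h.zero, h'.zero]
  neg x := by simp [h.neg, h'.neg]
  add x y := by
    apply max_le
    · exact (h.add x y).trans (add_le_add (le_max_left _ _) (le_max_left _ _))
    · exact (h'.add x y).trans (add_le_add (le_max_right _ _) (le_max_right _ _))
  cover s hs := by
    obtain ⟨ι, i1, c, h1, h2⟩ := h.cover s hs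
    obtain ⟨ι', i1', c', h1', h2'⟩ := h'.cover s hs
    refine ⟨ι × ι', inferInstance, fun x => (c x, c' x), ?_, ?_⟩
    · rw [Fintype.card_prod, pow_add]
      exact Nat.mul_le_mul h1 h1'
    · intro x y hx hy hc
      have hc' := Prod.mk.inj hc
      exact max_le (h2 x y ((le_max_left _ _).trans hx) ((le_max_left _ _).trans hy) hc'.1)
        (h2' x y ((le_max_right _ _).trans hx) ((le_max_right _ _).trans hy) hc'.2)

lemma fl_eq {s a b : ℝ} (hs : 0 < s) (ha : |a| ≤ 2 * s) (hb : |b| ≤ 2 * s)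
    (h : Fin.ofNat 10 (⌊a / (s/2)⌋ + 4).toNat = Fin.ofNat 10 (⌊b / (s/2)⌋ + 4).toNat) :
    |a - b| ≤ s / 2 := by
  have hs2 : 0 < s / 2 := by linarith
  have hr : ∀ z : ℝ, |z| ≤ 2 * s → -4 ≤ ⌊z / (s/2)⌋ ∧ ⌊z / (s/2)⌋ ≤ 4 := by
    intro z hz
    have := abs_le.mp hz
    constructor
    · rw [Int.le_floor, le_div_iff₀ hs2]; push_cast; linarith
    · have h1 : z / (s/2) ≤ 4 := by rw [div_le_iff₀ hs2]; linarith
      have h2 := Int.floor_le_floor h1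
      simpa using h2
  obtain ⟨a1, a2⟩ := hr a ha
  obtain ⟨b1, b2⟩ := hr b hb
  have h' := congrArg Fin.val h
  simp only [Fin.ofNat] at h'
  have he : ⌊a / (s/2)⌋ = ⌊b / (s/2)⌋ := by omega
  have := Int.abs_sub_lt_one_of_floor_eq_floor he
  rw [← sub_div, abs_div, abs_of_pos hs2, div_lt_one hs2] at this
  exact this.le

lemma Boh.chr (psi : AddChar G ℂ) : Boh (fun x => ‖1 - psi x‖) 1 where
  zero := by simp
  neg x := by
    rw [AddChar.map_neg_eq_conj, ← Complex.norm_conj (1 - psi x)]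
    simp
  add x y := by
    rw [AddChar.map_add_eq_mul]
    have : 1 - psi x * psi y = (1 - psi x) + psi x * (1 - psi y) := by ring
    rw [this]
    refine (norm_add_le _ _).trans ?_
    rw [norm_mul, AddChar.norm_apply, one_mul]
  cover s hs := by
    refine ⟨Fin 10 × Fin 10, inferInstance, fun x =>
      (Fin.ofNat 10 (⌊(1 - psi x).re / (s/2)⌋ + 4).toNat, Fin.ofNat 10 (⌊(1 - psi x).im / (s/2)⌋ + 4).toNat), ?_, ?_⟩
    · simp
    · intro x y hx hy hc
      have hc' := Prod.mk.inj hc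
      have h1 := fl_eq hs ((Complex.abs_re_le_norm _).trans hx) ((Complex.abs_re_le_norm _).trans hy) hc'.1
      have h2 := fl_eq hs ((Complex.abs_im_le_norm _).trans hx) ((Complex.abs_im_le_norm _).trans hy) hc'.2
      have e : ‖1 - psi (x - y)‖ = ‖(1 - psi x) - (1 - psi y)‖ := by
        have e1 : psi x = psi (x - y) * psi y := by
          rw [← AddChar.map_add_eq_mul]; congr 1; abel
        have e2 : (1 - psi x) - (1 - psi y) = psi y * (1 - psi (x - y)) := by
          rw [e1]; ring
        rw [e2, norm_mul, AddChar.norm_apply, one_mul]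
      rw [e]
      refine (Complex.norm_le_abs_re_add_abs_im _).trans ?_
      rw [Complex.sub_re, Complex.sub_im]
      linarith

lemma Boh.chrs : ∀ (r : ℕ) (lam : Fin r → AddChar G ℂ), ∃ mu : G → ℝ, Boh mu r ∧
    (∀ x i, ‖1 - lam i x‖ ≤ mu x) ∧ ∀ x, mu x ≤ 2 := by
  intro r
  induction r with
  | zero =>
    intro lam
    refine ⟨fun _ => 0, ⟨rfl, fun _ => rfl, fun _ _ => by simp, ?_⟩, fun x i => i.elim0, fun _ => by norm_num⟩
    intro s hs
    exact ⟨Unit, inferInstance, fun _ => (), by simp, fun _ _ _ _ _ => hs.le⟩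
  | succ r ih =>
    intro lam
    obtain ⟨mu, h1, h2, h3⟩ := ih (fun i => lam i.castSucc)
    refine ⟨_, h1.max (Boh.chr (lam (Fin.last r))), ?_, ?_⟩
    · intro x i
      refine Fin.lastCases ?_ ?_ i
      · exact le_max_right _ _
      · intro j; exact (h2 x j).trans (le_max_left _ _)
    · intro x
      apply max_le (h3 x)
      refine (norm_sub_le _ _).trans ?_
      rw [AddChar.norm_apply]; norm_num

lemma add_chars {nu : G → ℝ} {d r : ℕ} (h : Boh nu d) (lam : Fin r → AddChar G ℂ) (k1 k2 R : ℝ)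
    (hk1 : 0 < k1) (hk2 : 0 < k2) (hR : ∀ x, nu x ≤ R) :
    ∃ nu' : G → ℝ, Boh nu' (d + r) ∧ (∀ x, k1 * nu x ≤ nu' x) ∧
      (∀ x i, k2 * ‖1 - lam i x‖ ≤ nu' x) ∧ ∀ x, nu' x ≤ max (k1 * R) (k2 * 2) := by
  obtain ⟨mu, h1, h2, h3⟩ := Boh.chrs r lam
  refine ⟨_, (h.scale hk1).max (h1.scale hk2), ?_, ?_, ?_⟩
  · intro x; exact le_max_left _ _
  · intro x i; exact (mul_le_mul_of_nonneg_left (h2 x i) hk2.le).trans (le_max_right _ _)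
  · intro x
    exact max_le_max (mul_le_mul_of_nonneg_left (hR x) hk1.le) (mul_le_mul_of_nonneg_left (h3 x) hk2.le)

lemma sum_sub_le {E : Type*} [SeminormedAddCommGroup E] (B Bp : Finset G) (hB : B ⊆ Bp) (f : G → E)
    (hf : ∀ x, ‖f x‖ ≤ 1) : ‖∑ x ∈ Bp, f x - ∑ x ∈ B, f x‖ ≤ (Bp.card : ℝ) - B.card := by
  have : ∑ x ∈ Bp, f x - ∑ x ∈ B, f x = ∑ x ∈ Bp \ B, f x := by
    rw [← Finset.sum_sdiff hB]; abel
  rw [this]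
  refine (norm_sum_le _ _).trans ?_
  refine (Finset.sum_le_sum (fun x _ => hf x)).trans ?_
  rw [Finset.sum_const, nsmul_eq_mul, mul_one, Finset.card_sdiff_of_subset hB,
    Nat.cast_sub (Finset.card_le_card hB)]

lemma ft_shift_le {nu : G → ℝ} {d : ℕ} (h : Boh nu d) (s k eta : ℝ) (hs : 0 ≤ s) (hk : 0 ≤ k)
    (hreg : ((bl nu (s + k)).card : ℝ) ≤ (1 + eta) * (bl nu s).card) (chi : AddChar G ℂ)
    (hchi : ((bl nu s).card : ℝ) / 2 ≤ ‖ft (bl nu s) chi‖) (v : G) (hv : nu v ≤ k) :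
    ‖1 - chi v‖ ≤ 4 * eta := by
  set B := bl nu s with hB
  set Bp := bl nu (s + k) with hBp
  have hpos : 0 < (B.card : ℝ) := h.card_pos hs
  have h1 := sum_sub_le B Bp (bl_mono (by linarith)) (fun x => chi x) (fun x => by simp)
  set B' := B.image (fun x => x + v) with hB'
  have hinj : Function.Injective (fun x : G => x + v) := add_left_injective v
  have hsub : B' ⊆ Bp := by
    intro x hx
    obtain ⟨y, hy, rfl⟩ := Finset.mem_image.mp hx
    rw [hBp, mem_bl]
    have := h.add y v
    rw [hB, mem_bl] at hy
    linarith
  have h2 := sum_sub_le B' Bp hsub (fun x => chi x) (fun x => by simp)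
  have hc : B'.card = B.card := Finset.card_image_of_injective _ hinj
  have hs' : ∑ x ∈ B', chi x = chi v * ft B chi := by
    rw [hB', Finset.sum_image (fun a _ b _ hab => hinj hab)]
    unfold ft
    rw [Finset.mul_sum]
    apply Finset.sum_congr rfl; intro x _
    rw [AddChar.map_add_eq_mul, mul_comm]
  rw [hs', hc] at h2
  change ‖_ - ft B chi‖ ≤ _ at h1
  have h3 : ‖1 - chi v‖ * ‖ft B chi‖ ≤ 2 * eta * B.card := by
    rw [← norm_mul]
    have e : (1 - chi v) * ft B chi = (∑ x ∈ Bp, chi x - chi v * ft B chi) - (∑ x ∈ Bp, chi x - ft B chi) := by ring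
    rw [e]
    refine (norm_sub_le _ _).trans ?_
    linarith
  have h4 : ‖1 - chi v‖ * (B.card / 2) ≤ 2 * eta * B.card :=
    (mul_le_mul_of_nonneg_left hchi (norm_nonneg _)).trans h3
  nlinarith

lemma pch_le {r : ℕ} (lam : Fin r → AddChar G ℂ) (w : Fin r → ℤ) (hw : ∀ i, w i ∈ tri) (v : G) :
    ‖1 - pch lam w v‖ ≤ ∑ i, ‖1 - lam i v‖ := by
  have h1 : ∀ i, ‖1 - (lam i ^ w i) v‖ ≤ ‖1 - lam i v‖ := by
    intro i
    rcases tri_mem.mp (hw i) with h | h | h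
    · rw [h, zpow_neg_one, AddChar.inv_apply]
      exact ((Boh.chr (lam i)).neg v).le
    · rw [h]; simp
    · rw [h]; simp
  have h2 : ∀ s : Finset (Fin r), ‖1 - ∏ i ∈ s, (lam i ^ w i) v‖ ≤ ∑ i ∈ s, ‖1 - lam i v‖ := by
    intro s
    induction s using Finset.induction_on with
    | empty => simp
    | insert a s ha ih =>
      rw [Finset.prod_insert ha, Finset.sum_insert ha]
      set p := ∏ i ∈ s, (lam i ^ w i) v
      have : 1 - (lam a ^ w a) v * p = (1 - (lam a ^ w a) v) + (lam a ^ w a) v * (1 - p) := by ring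
      rw [this]
      refine (norm_add_le _ _).trans ?_
      rw [norm_mul, AddChar.norm_apply, one_mul]
      exact add_le_add (h1 a) ih
  unfold pch
  rw [AddChar.prod_apply]
  exact h2 _

lemma psi_close {r : ℕ} (lam : Fin r → AddChar G ℂ) (w : Fin r → ℤ) (hw : ∀ i, w i ∈ tri)
    (psi : AddChar G ℂ) (v : G) :
    ‖1 - psi v‖ ≤ ‖1 - (psi * pch lam w) v‖ + ∑ i, ‖1 - lam i v‖ := by
  have h1 := pch_le lam w hw v
  rw [AddChar.mul_apply]
  set p := pch lam w v
  have e : 1 - psi v = (1 - psi v * p) - psi v * (1 - p) := by ring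
  rw [e]
  refine (norm_sub_le _ _).trans ?_
  rw [norm_mul (psi v), AddChar.norm_apply, one_mul]
  linarith

end addch

section miss
variable {G : Type} [AddCommGroup G] [Fintype G] [DecidableEq G]

lemma cross (A B Bp : Finset G) (phi : G → G) (hphi : Function.Injective phi) (hAB : A ⊆ B)
    (hBB : B ⊆ Bp) (hmap : ∀ y ∈ B, phi y ∈ Bp) (eta : ℝ) (hc : (Bp.card : ℝ) ≤ (1 + eta) * B.card) :
    (A.card : ℝ) - eta * B.card ≤ ∑ y, ind A y * ind B (phi y) ∧
      ∑ y, ind A y * ind B (phi y) ≤ A.card := by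
  classical
  have e : ∑ y, ind A y * ind B (phi y) = ((A.filter (fun y => phi y ∈ B)).card : ℝ) := by
    rw [← sum_ind]
    apply Finset.sum_congr rfl; intro y _
    unfold ind
    by_cases h1 : y ∈ A <;> by_cases h2 : phi y ∈ B <;> simp [h1, h2]
  rw [e]
  constructor
  · have h1 : ((A.filter (fun y => ¬ phi y ∈ B)).card : ℝ) ≤ (Bp \ B).card := by
      apply Nat.cast_le.mpr
      apply Finset.card_le_card_of_injOn phi
      · intro y hy
        have hy' := Finset.mem_filter.mp (Finset.mem_coe.mp hy)
        exact Finset.mem_coe.mpr (Finset.mem_sdiff.mpr ⟨hmap y (hAB hy'.1), hy'.2⟩)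
      · intro x _ y _ h; exact hphi h
    rw [Finset.card_sdiff_of_subset hBB, Nat.cast_sub (Finset.card_le_card hBB)] at h1
    have h2 := Finset.card_filter_add_card_filter_not (s := A) (fun y => phi y ∈ B)
    have h3 : ((A.filter (fun y => phi y ∈ B)).card : ℝ) + (A.filter (fun y => ¬ phi y ∈ B)).card = A.card := by
      exact_mod_cast h2
    linarith
  · exact_mod_cast Finset.card_filter_le _ _

/-- balanced function -/
def bal (A B : Finset G) (a : ℝ) (x : G) : ℝ := ind A x / a - ind B x

lemma bal_cor {nu : G → ℝ} {d : ℕ} (hnu : Boh nu d) (A1 : Finset G) (a eta s k : ℝ) (ha : 0 < a)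
    (hk : 0 ≤ k) (hA : A1 ⊆ bl nu s) (hc : (A1.card : ℝ) = a * (bl nu s).card)
    (hreg : ((bl nu (s + k)).card : ℝ) ≤ (1 + eta) * (bl nu s).card) (z : G) (hz : nu z ≤ k) :
    (bl nu s).card + cor (bal A1 (bl nu s) a) z ≤ cor (ind A1) z / a ^ 2 + 2 * eta / a * (bl nu s).card ∧
    cor (ind A1) z / a ^ 2 - eta * (bl nu s).card ≤ (bl nu s).card + cor (bal A1 (bl nu s) a) z ∧
    cnv (bal A1 (bl nu s) a) z + (bl nu s).card ≤ cnv (ind A1) z / a ^ 2 + 2 * eta / a * (bl nu s).card := by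
  set B := bl nu s with hB
  set Bp := bl nu (s + k) with hBp
  have hBB : B ⊆ Bp := bl_mono (by linarith)
  have hp : ∀ y ∈ B, z + y ∈ Bp := by
    intro y hy
    rw [hB, mem_bl] at hy
    rw [hBp, mem_bl]
    have := hnu.add z y; linarith
  have hm : ∀ y ∈ B, y - z ∈ Bp := by
    intro y hy
    rw [hB, mem_bl] at hy
    rw [hBp, mem_bl]
    have := hnu.sub y z; linarith
  have hm' : ∀ y ∈ B, z - y ∈ Bp := by
    intro y hy
    rw [hB, mem_bl] at hy
    rw [hBp, mem_bl]
    have := hnu.sub z y; linarith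
  have c1 := cross A1 B Bp (fun y => z + y) (add_right_injective z) hA hBB hp eta hreg
  have c2 := cross A1 B Bp (fun y => y - z) (sub_left_injective) hA hBB hm eta hreg
  have c3 := cross A1 B Bp (fun y => z - y) (sub_right_injective) hA hBB hm' eta hreg
  have c4 := cross B B Bp (fun y => z + y) (add_right_injective z) (Finset.Subset.refl _) hBB hp eta hreg
  have c5 := cross B B Bp (fun y => z - y) (sub_right_injective) (Finset.Subset.refl _) hBB hm' eta hreg
  set W : ℝ := (B.card : ℝ) with hW
  have e1 : cor (bal A1 B a) z = cor (ind A1) z / a ^ 2 - (∑ y, ind A1 y * ind B (z + y)) / a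
      - (∑ y, ind A1 y * ind B (y - z)) / a + ∑ y, ind B y * ind B (z + y) := by
    have e0 : ∑ y, ind A1 y * ind B (y - z) = ∑ y, ind B y * ind A1 (z + y) := by
      rw [← Equiv.sum_comp (Equiv.addLeft z)]
      apply Finset.sum_congr rfl; intro y _
      simp only [Equiv.coe_addLeft, add_sub_cancel_left]
      ring
    rw [e0]
    unfold cor bal
    rw [Finset.sum_div, Finset.sum_div, Finset.sum_div, ← Finset.sum_sub_distrib,
      ← Finset.sum_sub_distrib, ← Finset.sum_add_distrib]
    apply Finset.sum_congr rfl; intro y _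
    field_simp
    ring
  have e2 : cnv (bal A1 B a) z = cnv (ind A1) z / a ^ 2 - (∑ y, ind A1 y * ind B (z - y)) / a
      - (∑ y, ind A1 y * ind B (z - y)) / a + ∑ y, ind B y * ind B (z - y) := by
    have e0 : ∑ y, ind A1 y * ind B (z - y) = ∑ y, ind B y * ind A1 (z - y) := by
      rw [← Equiv.sum_comp (Equiv.subLeft z)]
      apply Finset.sum_congr rfl; intro y _
      simp only [Equiv.subLeft_apply, sub_sub_cancel]
      ring
    nth_rewrite 2 [e0]
    unfold cnv bal
    rw [Finset.sum_div, Finset.sum_div, Finset.sum_div, ← Finset.sum_sub_distrib,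
      ← Finset.sum_sub_distrib, ← Finset.sum_add_distrib]
    apply Finset.sum_congr rfl; intro y _
    field_simp
    ring
  have hlow : ∀ t : ℝ, (A1.card : ℝ) - eta * W ≤ t → W - eta / a * W ≤ t / a := by
    intro t ht
    rw [le_div_iff₀ ha]
    have : (W - eta / a * W) * a = a * W - eta * W := by field_simp
    rw [this, ← hc]; exact ht
  have hupp : ∀ t : ℝ, t ≤ (A1.card : ℝ) → t / a ≤ W := by
    intro t ht
    rw [div_le_iff₀ ha]; rw [hc] at ht; linarith
  have l1 := hlow _ c1.1
  have l2 := hlow _ c2.1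
  have l3 := hlow _ c3.1
  have u1 := hupp _ c1.2
  have u2 := hupp _ c2.2
  have e3 : 2 * eta / a * W = eta / a * W + eta / a * W := by ring
  rw [e3]
  refine ⟨?_, ?_, ?_⟩
  · rw [e1]; linarith [c4.2]
  · rw [e1]; linarith [c4.1]
  · rw [e2]; linarith [c5.2]

lemma avg_moment {nu : G → ℝ} {d : ℕ} (hnu : Boh nu d) (f : G → ℝ) (C : Finset G) (s2 k2 s3 a2 q : ℝ)
    (hs2 : 0 ≤ s2) (hk2 : 0 ≤ k2)
    (hs3 : 2 * s3 ≤ k2) (hC : C ⊆ bl nu s2) (ha2 : a2 * (bl nu s2).card ≤ C.card)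
    (hreg : ((bl nu (s2 + k2)).card : ℝ) ≤ 2 * (bl nu s2).card) (p : ℕ) (hp : Even p) (hq : 0 ≤ q) (t : G)
    (hbig : ∀ c ∈ C, q ^ p ≤ cnv f (t - c) ^ p) :
    q ^ p * (a2 / 2) * ((bl nu s3).card : ℝ) ^ 2 ≤ ∑ b ∈ bl nu s3, ∑ c ∈ bl nu s3, cor f (b - c) ^ p := by
  set B3 := bl nu s3 with hB3
  set U := bl nu (s2 + k2) with hU
  set M := ∑ b ∈ B3, ∑ c ∈ B3, cor f (b - c) ^ p with hM
  have hUpos : (0:ℝ) < U.card := hnu.card_pos (by linarith)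
  have h1 : ∀ y ∈ U, ∑ b ∈ B3, ∑ c ∈ B3, cnv f (t - y + b - c) ^ p ≤ M := by
    intro y _
    apply sum_cnv_pow_le
    intro x hx
    rw [hB3, mem_bl] at *
    rw [hnu.neg]; exact hx
  have h2 := Finset.sum_le_sum h1
  rw [← sum3_comm] at h2
  have h3 : ∀ b ∈ B3, ∀ c ∈ B3, C.card * q ^ p ≤ ∑ y ∈ U, cnv f (t - y + b - c) ^ p := by
    intro b hb c hc
    rw [hB3, mem_bl] at hb hc
    calc (C.card : ℝ) * q ^ p = ∑ x ∈ C, q ^ p := by simp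
      _ ≤ ∑ x ∈ C, cnv f (t - x) ^ p := Finset.sum_le_sum hbig
      _ = ∑ y ∈ C.image (fun x => x + (b - c)), cnv f (t - y + b - c) ^ p := by
          rw [Finset.sum_image (by intro x _ y _ h; simpa using h)]
          apply Finset.sum_congr rfl; intro x _
          congr 2; abel
      _ ≤ _ := by
          apply Finset.sum_le_sum_of_subset_of_nonneg
          · intro y hy
            obtain ⟨x, hx, rfl⟩ := Finset.mem_image.mp hy
            have hx' := mem_bl.mp (hC hx)
            rw [hU, mem_bl]
            have a1 := hnu.add x (b - c)
            have a2 := hnu.sub b c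
            linarith
          · intro y _ _; exact hp.pow_nonneg _
  have h4 : (B3.card : ℝ) * (B3.card * (C.card * q ^ p)) ≤ U.card * M := by
    calc (B3.card : ℝ) * (B3.card * (C.card * q ^ p)) = ∑ b ∈ B3, ∑ c ∈ B3, (C.card * q ^ p : ℝ) := by simp
      _ ≤ ∑ b ∈ B3, ∑ c ∈ B3, ∑ y ∈ U, cnv f (t - y + b - c) ^ p :=
        Finset.sum_le_sum (fun b hb => Finset.sum_le_sum (fun c hc => h3 b hb c hc))
      _ ≤ _ := by simpa using h2
  have h5 : a2 / 2 * U.card ≤ C.card := by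
    by_cases h0 : 0 ≤ a2
    · have := mul_le_mul_of_nonneg_left hreg h0
      linarith
    · have : a2 / 2 * U.card ≤ 0 := mul_nonpos_of_nonpos_of_nonneg (by linarith) hUpos.le
      exact this.trans (Nat.cast_nonneg _)
  apply le_of_mul_le_mul_left _ hUpos
  calc (U.card : ℝ) * (q ^ p * (a2 / 2) * (B3.card : ℝ) ^ 2) = (a2 / 2 * U.card) * (q ^ p * (B3.card : ℝ) ^ 2) := by ring
    _ ≤ C.card * (q ^ p * (B3.card : ℝ) ^ 2) := mul_le_mul_of_nonneg_right h5 (by positivity)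
    _ = (B3.card : ℝ) * (B3.card * (C.card * q ^ p)) := by ring
    _ ≤ _ := h4

set_option maxHeartbeats 2000000 in
lemma exists_Aprime {nu : G → ℝ} {d : ℕ} (hnu : Boh nu d) (A1 : Finset G) (a eta s k : ℝ) (ha : 0 < a)
    (ha1 : a ≤ 1) (hs : 0 ≤ s)
    (hk : 0 ≤ k) (hA : A1 ⊆ bl nu s) (hc : (A1.card : ℝ) = a * (bl nu s).card)
    (heta0 : 0 ≤ eta) (heta : eta ≤ a / 1000)
    (hreg : ((bl nu (s + k)).card : ℝ) ≤ (1 + eta) * (bl nu s).card)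
    (C : Finset G) (s2 k2 s3 : ℝ)
    (hs2 : 0 ≤ s2) (hk2 : 0 ≤ k2) (hs30 : 0 ≤ s3)
    (hs3 : 2 * s3 ≤ k2) (hs3k : 2 * s3 ≤ k) (hC : C ⊆ bl nu s2) (ha2 : a / 2 * (bl nu s2).card ≤ C.card)
    (hreg2 : ((bl nu (s2 + k2)).card : ℝ) ≤ 2 * (bl nu s2).card) (p : ℕ) (hp : Even p) (hp30 : 30 ≤ p)
    (hpa : 4 / a ≤ (1.118 : ℝ) ^ p) (t : G)
    (ht : ∀ c ∈ C, nu (t - c) ≤ k ∧ cnv (ind A1) (t - c) = 0) :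
    ∃ A' ⊆ bl nu s3, A'.Nonempty ∧ a ^ (6 * p) / 160 * (bl nu s3).card ≤ A'.card ∧
      ∑ b ∈ A', ∑ c ∈ A', (if cor (ind A1) (b - c) < 1.2 * a ^ 2 * (bl nu s).card then (1 : ℝ) else 0) ≤
        1 / 40 * (A'.card : ℝ) ^ 2 := by
  have hWpos : (0 : ℝ) < (bl nu s).card := hnu.card_pos hs
  have hbc := fun z hz => bal_cor hnu A1 a eta s k ha hk hA hc hreg z hz
  have hB3 : (0 : ℝ) < (bl nu s3).card := hnu.card_pos hs30
  set B := bl nu s with hB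
  set W : ℝ := (B.card : ℝ) with hW
  set B3 := bl nu s3 with hB3def
  set f := bal A1 B a with hf
  have hea : 2 * eta / a ≤ 0.002 := by
    rw [div_le_iff₀ ha]; linarith
  have hea' : eta ≤ 0.002 := by linarith
  have m1 := avg_moment hnu f C s2 k2 s3 (a / 2) (0.9 * W) hs2 hk2 hs3 hC ha2 hreg2 p hp (by positivity) t (by
    intro c hcC
    obtain ⟨t1, t2⟩ := ht c hcC
    have h3 := (hbc _ t1).2.2
    rw [t2] at h3
    rw [← hp.neg_pow (cnv f (t - c))]
    apply pow_le_pow_left₀ (by positivity)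
    have := mul_le_mul_of_nonneg_right hea hWpos.le
    simp only [zero_div, zero_add] at h3
    linarith)
  have m2 : (0.9 : ℝ) ^ p * (a / 4) * (B3.card : ℝ) ^ 2 ≤ ∑ b ∈ B3, ∑ c ∈ B3, (cor f (b - c) / W) ^ p := by
    simp_rw [div_pow, ← Finset.sum_div]
    rw [le_div_iff₀ (by positivity)]
    refine le_trans (le_of_eq ?_) m1
    rw [mul_pow]; ring
  have m3 := unbalance f W hWpos B3 p
  have m4 : (1.3 : ℝ) ^ (6 * p) * (B3.card : ℝ) ^ 2 ≤ ∑ b ∈ B3, ∑ c ∈ B3, (1 + cor f (b - c) / W) ^ (6 * p) := by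
    refine le_trans ?_ m3
    refine le_trans ?_ (mul_le_mul_of_nonneg_left m2 (by positivity))
    have h1 : (1.118 : ℝ) ^ p * (1.3 : ℝ) ^ (6 * p) ≤ 6 ^ p * 0.9 ^ p := by
      rw [pow_mul, ← mul_pow, ← mul_pow]
      apply pow_le_pow_left₀ (by norm_num)
      norm_num
    have h2 : (1.3 : ℝ) ^ (6 * p) ≤ 6 ^ p * 0.9 ^ p * (a / 4) := by
      have h3 : 1 ≤ (1.118 : ℝ) ^ p * (a / 4) := by
        rw [div_le_iff₀ ha] at hpa; linarith
      calc (1.3 : ℝ) ^ (6 * p) = 1 * (1.3 : ℝ) ^ (6 * p) := by ring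
        _ ≤ ((1.118 : ℝ) ^ p * (a / 4)) * (1.3 : ℝ) ^ (6 * p) := mul_le_mul_of_nonneg_right h3 (by positivity)
        _ = ((1.118 : ℝ) ^ p * (1.3 : ℝ) ^ (6 * p)) * (a / 4) := by ring
        _ ≤ _ := mul_le_mul_of_nonneg_right h1 (by positivity)
    calc _ ≤ 6 ^ p * 0.9 ^ p * (a / 4) * (B3.card : ℝ) ^ 2 := mul_le_mul_of_nonneg_right h2 (by positivity)
      _ = _ := by ring
  have hP2 : Even (6 * p) := hp.mul_left 6
  set P := 6 * p with hPdef
  have hP : 180 ≤ P := by omega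
  have m5 : ∀ b ∈ B3, ∀ c ∈ B3, (1 + cor f (b - c) / W) ^ P ≤
      (1.002 : ℝ) ^ P * (cor (ind A1) (b - c) ^ P / (a ^ 2 * W) ^ P + 1) := by
    intro b hb c hcc
    have hn : nu (b - c) ≤ k := by
      have a1 := hnu.sub b c
      have a2 := mem_bl.mp hb
      have a3 := mem_bl.mp hcc
      linarith
    obtain ⟨h1, h2, -⟩ := hbc _ hn
    have hcn : 0 ≤ cor (ind A1) (b - c) := Finset.sum_nonneg (fun y _ => mul_nonneg (ind_nonneg _ _) (ind_nonneg _ _))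
    rw [← div_pow]
    set X := cor (ind A1) (b - c) / (a ^ 2 * W) with hX
    have hX0 : 0 ≤ X := by positivity
    have hXe : cor (ind A1) (b - c) / a ^ 2 = X * W := by
      rw [hX]; field_simp
    rw [hXe] at h1 h2
    have e1 : 1 + cor f (b - c) / W = (W + cor f (b - c)) / W := by field_simp
    have hab : |1 + cor f (b - c) / W| ≤ X + 0.002 := by
      rw [e1, abs_le]
      constructor
      · rw [le_div_iff₀ hWpos]
        have := mul_le_mul_of_nonneg_right hea' hWpos.le
        have h0 : 0 ≤ X * W := by positivity
        nlinarith
      · rw [div_le_iff₀ hWpos]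
        have := mul_le_mul_of_nonneg_right hea hWpos.le
        nlinarith
    rw [← hP2.pow_abs]
    have h3 : (X + 0.002) ^ P ≤ (1.002 : ℝ) ^ P * (X ^ P + 1) := by
      by_cases hx1 : 1 ≤ X
      · calc (X + 0.002) ^ P ≤ (1.002 * X) ^ P := pow_le_pow_left₀ (by positivity) (by linarith) P
          _ = (1.002 : ℝ) ^ P * X ^ P := mul_pow _ _ _
          _ ≤ _ := mul_le_mul_of_nonneg_left (by linarith) (by positivity)
      · calc (X + 0.002) ^ P ≤ (1.002) ^ P := pow_le_pow_left₀ (by positivity) (by linarith) P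
          _ = (1.002 : ℝ) ^ P * 1 := by ring
          _ ≤ _ := mul_le_mul_of_nonneg_left (by have : 0 ≤ X ^ P := by positivity
                                                 linarith) (by positivity)
    exact (pow_le_pow_left₀ (abs_nonneg _) hab P).trans h3
  have m6 := m4.trans (Finset.sum_le_sum (fun b hb => Finset.sum_le_sum (fun c hc => m5 b hb c hc)))
  simp_rw [← Finset.mul_sum, Finset.sum_add_distrib, ← Finset.sum_div] at m6
  simp only [Finset.sum_const, nsmul_eq_mul, mul_one] at m6
  have k1 : (1.002 : ℝ) ^ P * ((1.25 : ℝ) ^ P + 1) ≤ (1.3 : ℝ) ^ P := by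
    have a1 : (1.25 : ℝ) ^ P + 1 ≤ (1.29 : ℝ) ^ P := by
      have b1 : (2 : ℝ) ≤ (1.03 : ℝ) ^ P := by
        calc (2 : ℝ) ≤ (1.03 : ℝ) ^ 180 := by norm_num
          _ ≤ _ := pow_le_pow_right₀ (by norm_num) hP
      have b2 : (1 : ℝ) ≤ (1.25 : ℝ) ^ P := one_le_pow₀ (by norm_num)
      calc (1.25 : ℝ) ^ P + 1 ≤ (1.25 : ℝ) ^ P * 2 := by linarith
        _ ≤ (1.25 : ℝ) ^ P * (1.03 : ℝ) ^ P := mul_le_mul_of_nonneg_left b1 (by positivity)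
        _ = (1.25 * 1.03 : ℝ) ^ P := (mul_pow _ _ _).symm
        _ ≤ _ := pow_le_pow_left₀ (by norm_num) (by norm_num) P
    calc _ ≤ (1.002 : ℝ) ^ P * (1.29 : ℝ) ^ P := mul_le_mul_of_nonneg_left a1 (by positivity)
      _ = (1.002 * 1.29 : ℝ) ^ P := (mul_pow _ _ _).symm
      _ ≤ _ := pow_le_pow_left₀ (by norm_num) (by norm_num) P
  set MM := ∑ b ∈ B3, ∑ c ∈ B3, cor (ind A1) (b - c) ^ P with hMM
  have m7 : (1.25 : ℝ) ^ P * (B3.card : ℝ) ^ 2 ≤ MM / (a ^ 2 * W) ^ P := by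
    have z1 : (1.002 : ℝ) ^ P * (((1.25 : ℝ) ^ P + 1) * (B3.card : ℝ) ^ 2) ≤
        (1.002 : ℝ) ^ P * (MM / (a ^ 2 * W) ^ P + (B3.card : ℝ) * B3.card) := by
      refine le_trans ?_ m6
      rw [← mul_assoc]
      exact mul_le_mul_of_nonneg_right k1 (by positivity)
    have z2 := le_of_mul_le_mul_left z1 (by positivity)
    nlinarith
  rw [le_div_iff₀ (by positivity)] at m7
  have hsift := sifting A1 B3 P (1.2 * a ^ 2 * W) (1.25 * a ^ 2 * W) (1 / 40) (a ^ P / 160)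
    (by positivity) (by positivity) ⟨0, hnu.zero_mem hs30⟩ (by norm_num) (by norm_num) (by positivity)
    (by
      refine le_trans (le_of_eq ?_) m7
      rw [mul_assoc 1.25, mul_pow]; ring)
    (by
      have b1 : (160 : ℝ) ≤ (1.04 : ℝ) ^ P := by
        calc (160 : ℝ) ≤ (1.04 : ℝ) ^ 180 := by norm_num
          _ ≤ _ := pow_le_pow_right₀ (by norm_num) hP
      have b2 : (1.2 * a ^ 2 * W) ^ P * (1.04 : ℝ) ^ P ≤ (1.25 * a ^ 2 * W) ^ P := by
        rw [← mul_pow]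
        apply pow_le_pow_left₀ (by positivity)
        have : 0 < a ^ 2 * W := by positivity
        nlinarith
      have b3 : 0 ≤ (1.2 * a ^ 2 * W) ^ P := by positivity
      nlinarith)
    (by
      rw [hc]
      have b1 : a ^ P / 160 * (a * W) ^ P = 1 / 160 * (a ^ 2 * W) ^ P := by
        rw [mul_pow, mul_pow, ← pow_mul]; ring
      rw [b1]
      have b2 : (a ^ 2 * W) ^ P ≤ (1.25 * a ^ 2 * W) ^ P := by
        apply pow_le_pow_left₀ (by positivity)
        have : 0 < a ^ 2 * W := by positivity
        nlinarith
      linarith)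
  exact hsift

end miss

section incr
variable {G : Type} [AddCommGroup G] [Fintype G] [DecidableEq G]

lemma QQ_zero_lower (A1 A' T : Finset G) (m : ℕ) (th : ℝ) (hth : 0 ≤ th) (S h : G → ℝ)
    (hS : ∀ z, th * S z ≤ cor (ind A1) z)
    (hAne : A'.Nonempty) (hh : ∀ x, h x = (∑ a ∈ A', S (a - x)) / A'.card)
    (hlow : ∀ t t' : Fin m → G, (∀ i, t i ∈ T) → (∀ i, t' i ∈ T) →
      0.95 * (A'.card : ℝ) ≤ ∑ x ∈ A', h (x + (∑ i, t i - ∑ i, t' i))) :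
    0.95 * th * ((A'.card : ℝ) ^ 2 * ((T.card : ℝ) ^ m) ^ 2) ≤ QQ A1 A' T m 0 := by
  have hA : (0 : ℝ) < A'.card := by exact_mod_cast hAne.card_pos
  unfold QQ
  set TT := Fintype.piFinset (fun _ : Fin m => T) with hTT
  have hTTc : (TT.card : ℝ) = (T.card : ℝ) ^ m := by
    rw [hTT, Fintype.card_piFinset]; simp
  have sw : ∑ a ∈ A', ∑ x ∈ A', ∑ t ∈ TT, ∑ t' ∈ TT, cor (ind A1) (a - (x + (∑ i, t i - ∑ i, t' i)) + 0)
      = ∑ t ∈ TT, ∑ t' ∈ TT, ∑ x ∈ A', ∑ a ∈ A', cor (ind A1) (a - (x + (∑ i, t i - ∑ i, t' i))) := by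
    simp only [add_zero]
    calc _ = ∑ t ∈ TT, ∑ a ∈ A', ∑ x ∈ A', ∑ t' ∈ TT, cor (ind A1) (a - (x + (∑ i, t i - ∑ i, t' i))) := by
          exact sum3_comm A' A' TT (fun a x t => ∑ t' ∈ TT, cor (ind A1) (a - (x + (∑ i, t i - ∑ i, t' i))))
      _ = ∑ t ∈ TT, ∑ t' ∈ TT, ∑ a ∈ A', ∑ x ∈ A', cor (ind A1) (a - (x + (∑ i, t i - ∑ i, t' i))) := by
          apply Finset.sum_congr rfl; intro t _
          exact sum3_comm A' A' TT (fun a x t' => cor (ind A1) (a - (x + (∑ i, t i - ∑ i, t' i))))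
      _ = _ := by
          apply Finset.sum_congr rfl; intro t _
          apply Finset.sum_congr rfl; intro t' _
          rw [Finset.sum_comm]
  rw [sw]
  calc 0.95 * th * ((A'.card : ℝ) ^ 2 * ((T.card : ℝ) ^ m) ^ 2)
      = ∑ t ∈ TT, ∑ t' ∈ TT, th * A'.card * (0.95 * A'.card) := by
        simp only [Finset.sum_const, nsmul_eq_mul, hTTc]; ring
    _ ≤ _ := by
        apply Finset.sum_le_sum; intro t ht
        apply Finset.sum_le_sum; intro t' ht'
        have h1 := hlow t t' (Fintype.mem_piFinset.mp ht) (Fintype.mem_piFinset.mp ht')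
        refine (mul_le_mul_of_nonneg_left h1 (by positivity)).trans ?_
        rw [Finset.mul_sum]
        apply Finset.sum_le_sum; intro x _
        rw [hh]
        have e : th * A'.card * ((∑ a ∈ A', S (a - (x + (∑ i, t i - ∑ i, t' i)))) / A'.card) =
            ∑ a ∈ A', th * S (a - (x + (∑ i, t i - ∑ i, t' i))) := by
          rw [← Finset.mul_sum]; field_simp
        rw [e]
        exact Finset.sum_le_sum (fun a _ => hS _)

set_option maxHeartbeats 1000000 in
lemma incr_core {nu : G → ℝ} {d : ℕ} (hnu : Boh nu d) (A1 A' : Finset G)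
    (a W del s3 k3 s4 k4 s5 k5 eta : ℝ) (m k n : ℕ) (ha : 0 < a) (hW : 0 < W)
    (hc : (A1.card : ℝ) = a * W) (hA' : A' ⊆ bl nu s3) (hAne : A'.Nonempty) (hdel : 0 < del)
    (hAc : del * (bl nu s3).card ≤ A'.card)
    (hbad : ∑ b ∈ A', ∑ c ∈ A', (if cor (ind A1) (b - c) < 1.2 * a ^ 2 * W then (1 : ℝ) else 0) ≤
        1 / 40 * (A'.card : ℝ) ^ 2)
    (hs4 : 0 ≤ s4) (hs5 : 0 ≤ s5) (hk4 : 0 ≤ k4) (hk5 : 0 ≤ k5) (hm : 0 < m) (hk : 0 < k) (hn0 : 0 < n)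
    (hr3 : ((bl nu (s3 + k3)).card : ℝ) ≤ 2 * (bl nu s3).card) (hms : 2 * m * s4 ≤ k3)
    (hkk : 1280 * m / del ≤ Real.exp (k / (51200 * (m : ℝ) ^ 2)))
    (hr4 : ((bl nu (s4 + k4)).card : ℝ) ≤ 2 * (bl nu s4).card) (hns : n * s5 ≤ k4)
    (hn : 8 * (2 / del) ^ k < Real.exp (n / 32))
    (hr5 : ((bl nu (s5 + k5)).card : ℝ) ≤ (1 + eta) * (bl nu s5).card) (heta : eta ≤ 1 / 320)
    (ham : 40 ≤ a * 4 ^ m) :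
    ∃ r ≤ n, ∃ lam : Fin r → AddChar G ℂ, ∀ V : Finset G, V.Nonempty →
      (∀ v ∈ V, nu v ≤ k5 ∧ ∀ i, ‖1 - lam i v‖ ≤ 1 / (80 * n)) →
      ∃ x, 1.05 * a * V.card ≤ ((V.filter (fun v => x + v ∈ A1)).card : ℝ) := by
  classical
  have hm1 : (1 : ℝ) ≤ m := by exact_mod_cast hm
  have hn1 : (1 : ℝ) ≤ n := by exact_mod_cast hn0
  have hAp : (0 : ℝ) < A'.card := by exact_mod_cast hAne.card_pos
  set th := 1.2 * a ^ 2 * W with hth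
  have hthpos : 0 < th := by positivity
  set X := bl nu (s3 + k3) with hX
  set B4 := bl nu s4 with hB4
  have hB4pos : (0 : ℝ) < B4.card := hnu.card_pos hs4
  set S : G → ℝ := fun z => if cor (ind A1) z < th then 0 else 1 with hS
  have hs4k : s4 ≤ k3 := by nlinarith
  have hXA : (X.card : ℝ) ≤ 2 / del * A'.card := by
    rw [div_mul_eq_mul_div, le_div_iff₀ hdel]
    have := mul_le_mul_of_nonneg_right hr3 hdel.le
    linarith
  obtain ⟨T, hTB, hTc, g, hg⟩ := croot_sisask A' B4 X X S
    (by intro x; simp only [hS]; split_ifs <;> norm_num)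
    (by intro x; simp only [hS]; split_ifs <;> norm_num) hAne ⟨0, hnu.zero_mem hs4⟩
    (by
      intro x hx y hy
      rw [hX, mem_bl]
      have a1 := hnu.sub x y
      have a2 := mem_bl.mp (hA' hx)
      have a3 := mem_bl.mp hy
      linarith) k hk (1 / (160 * m)) (by positivity)
  set h : G → ℝ := fun x => (∑ a ∈ A', S (a - x)) / A'.card with hh
  -- the size of T
  have hT1 : (B4.card : ℝ) ≤ 2 * T.card * (2 / del) ^ k := by
    have h1 : (X.card : ℝ) ^ k ≤ (2 / del) ^ k * (A'.card : ℝ) ^ k := by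
      rw [← mul_pow]; exact pow_le_pow_left₀ (Nat.cast_nonneg _) hXA k
    have h2 : (A'.card : ℝ) ^ k * B4.card ≤ (A'.card : ℝ) ^ k * (2 * T.card * (2 / del) ^ k) := by
      refine hTc.trans ?_
      refine (mul_le_mul_of_nonneg_left h1 (by positivity)).trans (le_of_eq (by ring))
    exact le_of_mul_le_mul_left h2 (by positivity)
  have hTpos : (0 : ℝ) < T.card := by
    by_contra hcon
    have : (T.card : ℝ) = 0 := le_antisymm (not_lt.mp hcon) (Nat.cast_nonneg _)
    rw [this] at hT1; linarith
  -- error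
  set E := 4 * Real.exp (-(k * (1 / (160 * (m : ℝ))) ^ 2 / 2)) * X.card with hE
  have hEle : E ≤ A'.card / (160 * m) := by
    have e1 : (k : ℝ) * (1 / (160 * (m : ℝ))) ^ 2 / 2 = k / (51200 * (m : ℝ) ^ 2) := by
      field_simp; norm_num
    have e2 : Real.exp (-(k / (51200 * (m : ℝ) ^ 2))) ≤ del / (1280 * m) := by
      rw [Real.exp_neg]
      have : del / (1280 * m) = (1280 * m / del)⁻¹ := by rw [inv_div]
      rw [this]
      exact inv_anti₀ (by positivity) hkk
    rw [hE, e1]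
    calc _ ≤ 4 * (del / (1280 * m)) * (2 / del * A'.card) := by
          apply mul_le_mul _ hXA (Nat.cast_nonneg _) (by positivity)
          linarith
      _ = _ := by field_simp; norm_num
  have hbase : 39 / 40 * (A'.card : ℝ) ≤ ∑ x ∈ A', h x := by
    simp only [hh]
    rw [← Finset.sum_div, le_div_iff₀ hAp, Finset.sum_comm]
    have e1 : ∑ b ∈ A', ∑ c ∈ A', S (b - c) + ∑ b ∈ A', ∑ c ∈ A', (if cor (ind A1) (b - c) < th then (1 : ℝ) else 0)
        = (A'.card : ℝ) ^ 2 := by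
      simp_rw [← Finset.sum_add_distrib]
      have : ∀ b c : G, S (b - c) + (if cor (ind A1) (b - c) < th then (1 : ℝ) else 0) = 1 := by
        intro b c; simp only [hS]; split_ifs <;> norm_num
      simp_rw [this]
      simp; ring
    nlinarith
  have hit := iter_shift hnu A' T X h g
    (by
      intro x; simp only [hh]
      apply div_nonneg _ hAp.le
      apply Finset.sum_nonneg; intro z _; simp only [hS]; split_ifs <;> norm_num)
    (by
      intro x; simp only [hh]
      rw [div_le_one hAp]
      calc _ ≤ ∑ z ∈ A', (1 : ℝ) := Finset.sum_le_sum (fun z _ => by simp only [hS]; split_ifs <;> norm_num)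
        _ = _ := by simp)
    (1 / (160 * m)) E s3 s4 m hs4 hA' hTB (bl_mono (by linarith)) (by positivity) hg m le_rfl
  have hlow : ∀ t t' : Fin m → G, (∀ i, t i ∈ T) → (∀ i, t' i ∈ T) →
      0.95 * (A'.card : ℝ) ≤ ∑ x ∈ A', h (x + (∑ i, t i - ∑ i, t' i)) := by
    intro t t' ht ht'
    refine le_trans ?_ (hit t t' ht ht')
    have e1 : (m : ℝ) * (2 * (1 / (160 * m)) * A'.card + 2 * E) ≤ A'.card / 40 := by
      calc (m : ℝ) * (2 * (1 / (160 * m)) * A'.card + 2 * E) ≤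
          m * (2 * (1 / (160 * m)) * A'.card + 2 * (A'.card / (160 * m))) := by
            apply mul_le_mul_of_nonneg_left _ (by positivity); linarith
        _ = _ := by field_simp; norm_num
    linarith
  have hQ0 := QQ_zero_lower A1 A' T m th hthpos.le S h
    (by
      intro z; simp only [hS]
      split_ifs with hz
      · rw [mul_zero]
        exact Finset.sum_nonneg (fun y _ => mul_nonneg (ind_nonneg _ _) (ind_nonneg _ _))
      · rw [mul_one]; exact not_lt.mp hz) hAne (fun x => rfl) hlow
  obtain ⟨r, hrn, lam, hlam⟩ := chang T B4 (bl nu (s4 + k4)) (bl nu s5) n hTB ⟨0, hnu.zero_mem hs5⟩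
    (by
      intro x hx y hy
      rw [mem_bl]
      have a1 := hnu.sub x (∑ i, y i)
      have a2 := hnu.sum_le Finset.univ y s5 (fun i _ => mem_bl.mp (hy i))
      simp only [Finset.card_univ, Fintype.card_fin] at a2
      have a3 := mem_bl.mp hx
      linarith) hr4
    (by
      calc 4 * (B4.card : ℝ) ≤ T.card * (8 * (2 / del) ^ k) := by linarith
        _ < _ := mul_lt_mul_of_pos_left hn hTpos)
  refine ⟨r, hrn, lam, ?_⟩
  intro V hV hVprop
  by_contra hcon
  push Not at hcon
  have hVpos : (0 : ℝ) < V.card := by exact_mod_cast hV.card_pos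
  have hup := QQ_upper A1 A' T V m (1.05 * a * V.card) (fun x => (hcon x).le)
  set K := (A'.card : ℝ) ^ 2 * ((T.card : ℝ) ^ m) ^ 2 with hK
  have hKpos : 0 < K := by positivity
  have hpt : ∀ v ∈ V, 1.06 * (a * (a * W)) * K ≤ QQ A1 A' T m v := by
    intro v hv
    obtain ⟨v1, v2⟩ := hVprop v hv
    have hsh := QQ_shift A1 A' T m v (1 / 40) (by norm_num) (by norm_num) (by
      intro psi hpsi
      obtain ⟨w, hw, hw2⟩ := hlam psi hpsi
      have b1 := psi_close lam w hw psi v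
      have b2 := ft_shift_le hnu s5 k5 eta hs5 hk5 hr5 _ hw2 v v1
      have b3 : ∑ i, ‖1 - lam i v‖ ≤ 1 / 80 := by
        calc _ ≤ ∑ i : Fin r, (1 / (80 * n) : ℝ) := Finset.sum_le_sum (fun i _ => v2 i)
          _ = r * (1 / (80 * n)) := by simp
          _ ≤ n * (1 / (80 * n)) := mul_le_mul_of_nonneg_right (by exact_mod_cast hrn) (by positivity)
          _ = 1 / 80 := by field_simp
      linarith)
    have e1 : 2 * (A'.card : ℝ) ^ 2 * ((T.card : ℝ) ^ 2 / 4) ^ m * A1.card = K * (a * W) * (2 / 4 ^ m) := by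
      rw [hc, div_pow, hK]; ring
    have e2 : (2 : ℝ) / 4 ^ m ≤ a / 20 := by
      rw [div_le_iff₀ (by positivity)]; linarith
    have e3 := mul_le_mul_of_nonneg_left e2 (by positivity : 0 ≤ K * (a * W))
    rw [e1] at hsh
    have e4 : 0 < K * (a * (a * W)) := by positivity
    have e5 : 0.95 * th * K = 1.14 * (K * (a * (a * W))) := by rw [hth]; ring
    rw [e5] at hQ0
    nlinarith
  have hsum := Finset.sum_le_sum hpt
  rw [Finset.sum_const, nsmul_eq_mul] at hsum
  have hfin := hsum.trans hup
  rw [hc] at hfin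
  have e6 : 0 < V.card * (a * (a * W) * K) := by positivity
  nlinarith

end incr

section stp
variable {G : Type} [AddCommGroup G] [Fintype G] [DecidableEq G]

lemma avg_dense {nu : G → ℝ} {d : ℕ} (hnu : Boh nu d) (A1 : Finset G) (a s k s2 : ℝ) (ha : 0 < a)
    (hs : 0 ≤ s) (hk : 0 ≤ k) (hA : A1 ⊆ bl nu s) (hc : (A1.card : ℝ) = a * (bl nu s).card)
    (hreg : ((bl nu (s + k)).card : ℝ) ≤ 2 * (bl nu s).card) (hs2 : s2 ≤ k) :
    ∃ y, a / 2 * (bl nu s2).card ≤ (((bl nu s2).filter (fun c => c + y ∈ A1)).card : ℝ) := by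
  by_contra hcon
  push Not at hcon
  set U := bl nu (s + k) with hU
  have hUne : U.Nonempty := ⟨0, hnu.zero_mem (by linarith)⟩
  have h1 : ∑ y ∈ U, (((bl nu s2).filter (fun c => c + y ∈ A1)).card : ℝ) < ∑ y ∈ U, a / 2 * (bl nu s2).card :=
    Finset.sum_lt_sum_of_nonempty hUne (fun y _ => hcon y)
  simp_rw [← Finset.sum_boole] at h1
  rw [Finset.sum_comm] at h1
  have h2 : ∀ c ∈ bl nu s2, (A1.card : ℝ) ≤ ∑ y ∈ U, (if c + y ∈ A1 then (1 : ℝ) else 0) := by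
    intro c hcc
    rw [Finset.sum_boole]
    apply Nat.cast_le.mpr
    apply Finset.card_le_card_of_injOn (fun z => z - c)
    · intro z hz
      have hz' := Finset.mem_coe.mp hz
      apply Finset.mem_coe.mpr
      rw [Finset.mem_filter]
      refine ⟨?_, by simpa using hz'⟩
      rw [hU, mem_bl]
      have a1 := hnu.sub z c
      have a2 := mem_bl.mp (hA hz')
      have a3 := mem_bl.mp hcc
      linarith
    · intro u _ v _ huv; simpa using huv
  have h3 := Finset.sum_le_sum h2
  simp only [Finset.sum_const, nsmul_eq_mul] at h1 h3
  have h4 : (U.card : ℝ) * (a / 2 * (bl nu s2).card) ≤ (bl nu s2).card * A1.card := by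
    rw [hc]
    have := mul_le_mul_of_nonneg_right hreg (by positivity : 0 ≤ a / 2 * (bl nu s2).card)
    linarith
  linarith

lemma Boh.reg' {nu : G → ℝ} {d : ℕ} (h : Boh nu d) {D m : ℕ} {eta q : ℝ} (hdD : d ≤ D) (hD : 0 < D)
    (heta : 0 < eta) (hm : 99 ≤ m * eta) (hq : q = 1 / (4 * m * D)) {u : ℝ} (hu : 0 < u) :
    ∃ s, u / 2 ≤ s ∧ s ≤ u ∧
      ((bl nu (s + q * u)).card : ℝ) ≤ (1 + eta) * (bl nu s).card := by
  obtain ⟨s, h1, h2, h3, h4⟩ := h.reg hdD hD heta hm hu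
  refine ⟨s, h1, h2, ?_⟩
  rw [hq]
  refine h4.trans ?_
  apply mul_le_mul_of_nonneg_left _ (by linarith)
  apply Nat.cast_le.mpr
  apply Finset.card_le_card
  apply bl_mono
  have : 0 ≤ 1 / (4 * (m : ℝ) * D) * u := by positivity
  linarith

set_option maxHeartbeats 4000000 in
lemma step {nu : G → ℝ} {d : ℕ} (hnu : Boh nu d) (A : Finset G) (a0 eta q R : ℝ) (D M0 p m k n : ℕ)
    (ha0 : 0 < a0) (heta : eta = a0 / 1000) (hM0 : 99 ≤ M0 * eta) (hD : d + n ≤ D)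
    (hp : Even p) (hp30 : 30 ≤ p) (hpa : 4 / a0 ≤ (1.118 : ℝ) ^ p) (hm : 0 < m) (ham : 40 ≤ a0 * 4 ^ m)
    (hk : 0 < k) (hkk : 1280 * m / (a0 ^ (6 * p) / 160) ≤ Real.exp (k / (51200 * (m : ℝ) ^ 2)))
    (hn0 : 0 < n) (hn : 8 * (2 / (a0 ^ (6 * p) / 160)) ^ k < Real.exp (n / 32))
    (hq : q = 1 / (4 * M0 * D)) (hR : ∀ x, nu x ≤ R) (hR1 : 1 ≤ R)
    (s : ℝ) (hs : 1 / 2 ≤ s) (hs1 : s ≤ 1)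
    (hreg : ((bl nu (s + q)).card : ℝ) ≤ (1 + eta) * (bl nu s).card) (x : G) (a : ℝ) (ha : a0 ≤ a)
    (hden : (((bl nu s).filter (fun v => x + v ∈ A)).card : ℝ) = a * (bl nu s).card) :
    (∃ g, ∀ t, nu t ≤ q ^ 2 / 4 → g + t ∈ A + A + A) ∨
    ∃ (nu' : G → ℝ) (d' : ℕ), Boh nu' d' ∧ d' ≤ d + n ∧ (∀ x, nu x ≤ nu' x) ∧
      (∀ x, nu' x ≤ R * (8 * m * n / q ^ 5)) ∧ ∃ s', 1 / 2 ≤ s' ∧ s' ≤ 1 ∧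
      ((bl nu' (s' + q)).card : ℝ) ≤ (1 + eta) * (bl nu' s').card ∧
      ∃ x', 1.05 * a * (bl nu' s').card ≤ (((bl nu' s').filter (fun v => x' + v ∈ A)).card : ℝ) := by
  classical
  have hm1 : (1 : ℝ) ≤ m := by exact_mod_cast hm
  have hn1 : (1 : ℝ) ≤ n := by exact_mod_cast hn0
  have heta0 : 0 < eta := by rw [heta]; positivity
  have hapos : 0 < a := by linarith
  have hWpos : (0 : ℝ) < (bl nu s).card := hnu.card_pos (by linarith)
  have ha1 : a ≤ 1 := by
    have h1 : (((bl nu s).filter (fun v => x + v ∈ A)).card : ℝ) ≤ (bl nu s).card := by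
      exact_mod_cast Finset.card_filter_le _ _
    rw [hden] at h1
    by_contra hcon
    nlinarith
  have hD0 : 0 < D := by omega
  have hD1 : (1 : ℝ) ≤ D := by exact_mod_cast hD0
  have hM1 : (1 : ℝ) ≤ M0 := by
    have h0 : 0 < (M0 : ℝ) := by
      by_contra hcon
      have : (M0 : ℝ) = 0 := le_antisymm (not_lt.mp hcon) (Nat.cast_nonneg _)
      rw [this] at hM0; linarith
    have : 0 < M0 := by exact_mod_cast h0
    exact_mod_cast this
  have hq0 : 0 < q := by rw [hq]; positivity
  have hq4 : q ≤ 1 / 4 := by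
    rw [hq]
    apply one_div_le_one_div_of_le (by norm_num)
    nlinarith [mul_nonneg (by linarith : (0:ℝ) ≤ M0 - 1) (by linarith : (0:ℝ) ≤ D - 1)]
  have hdD : d ≤ D := by omega
  have heta1 : 1 + eta ≤ 2 := by rw [heta]; linarith
  have two : ∀ {u v : ℝ}, 0 ≤ v → u ≤ (1 + eta) * v → u ≤ 2 * v := fun {u v} hv h =>
    h.trans (mul_le_mul_of_nonneg_right heta1 hv)
  set A1 := (bl nu s).filter (fun v => x + v ∈ A) with hA1
  have hA1B : A1 ⊆ bl nu s := Finset.filter_subset _ _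
  -- second scale
  obtain ⟨s2, s2l, s2u, s2r⟩ := hnu.reg' hdD hD0 heta0 hM0 hq (u := q / 2) (by positivity)
  obtain ⟨s3, s3l, s3u, s3r⟩ := hnu.reg' hdD hD0 heta0 hM0 hq (u := q ^ 2 / 4) (by positivity)
  obtain ⟨s4, s4l, s4u, s4r⟩ := hnu.reg' hdD hD0 heta0 hM0 hq (u := q ^ 3 / (8 * m)) (by positivity)
  obtain ⟨s5, s5l, s5u, s5r⟩ := hnu.reg' hdD hD0 heta0 hM0 hq (u := q ^ 4 / (8 * m * n)) (by positivity)
  have p2 : 0 < q / 2 := by positivity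
  have p3 : 0 < q ^ 2 / 4 := by positivity
  have p4 : 0 < q ^ 3 / (8 * m) := by positivity
  have p5 : 0 < q ^ 4 / (8 * m * n) := by positivity
  have q2 : q ^ 2 ≤ q / 4 := by nlinarith
  obtain ⟨y, hy⟩ := avg_dense hnu A1 a s q s2 hapos (by linarith) hq0.le hA1B hden
    (two hWpos.le hreg) (by linarith)
  set C := (bl nu s2).filter (fun c => c + y ∈ A1) with hC
  by_cases hall : ∀ t, nu t ≤ q ^ 2 / 4 → (y + (x + x + x)) + t ∈ A + A + A
  · exact Or.inl ⟨_, hall⟩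
  right
  push Not at hall
  obtain ⟨t, htn, htA⟩ := hall
  obtain ⟨A', hA'B, hA'ne, hA'c, hA'bad⟩ := exists_Aprime hnu A1 a eta s q hapos ha1 (by linarith) hq0.le hA1B hden
    heta0.le (by rw [heta]; linarith) hreg C s2 (q * (q / 2)) s3 (by linarith) (by positivity) (by linarith)
    (by nlinarith) (by linarith) (Finset.filter_subset _ _) hy
    (two (Nat.cast_nonneg _) s2r) p hp hp30
    (by
      refine le_trans ?_ hpa
      exact div_le_div_of_nonneg_left (by norm_num) ha0 ha) t
    (by
      intro c hc
      obtain ⟨hc1, hc2⟩ := Finset.mem_filter.mp hc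
      have hc1' := mem_bl.mp hc1
      constructor
      · have := hnu.sub t c
        linarith
      · apply Finset.sum_eq_zero
        intro z _
        unfold ind
        by_cases hz : z ∈ A1
        · by_cases hz2 : t - c - z ∈ A1
          · exfalso
            apply htA
            have b1 := (Finset.mem_filter.mp hz).2
            have b2 := (Finset.mem_filter.mp hz2).2
            have b3 := (Finset.mem_filter.mp hc2).2
            have e : (y + (x + x + x)) + t = (x + z) + (x + (t - c - z)) + (x + (c + y)) := by abel
            rw [e]
            exact Finset.add_mem_add (Finset.add_mem_add b1 b2) b3
          · rw [if_neg hz2, mul_zero]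
        · rw [if_neg hz, zero_mul])
  have hdelle : a0 ^ (6 * p) / 160 * ((bl nu s3).card : ℝ) ≤ A'.card := by
    refine le_trans ?_ hA'c
    apply mul_le_mul_of_nonneg_right _ (Nat.cast_nonneg _)
    apply div_le_div_of_nonneg_right _ (by norm_num)
    exact pow_le_pow_left₀ ha0.le ha _
  obtain ⟨r, hrn, lam, hlam⟩ := incr_core hnu A1 A' a (bl nu s).card (a0 ^ (6 * p) / 160) s3 (q * (q ^ 2 / 4)) s4
    (q * (q ^ 3 / (8 * m))) s5 (q * (q ^ 4 / (8 * m * n))) eta m k n hapos hWpos hden hA'B hA'ne (by positivity) hdelle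
    hA'bad (by linarith) (by linarith) (by positivity) (by positivity) hm hk hn0
    (two (Nat.cast_nonneg _) s3r)
    (by
      calc 2 * m * s4 ≤ 2 * m * (q ^ 3 / (8 * m)) := mul_le_mul_of_nonneg_left s4u (by positivity)
        _ = q * (q ^ 2 / 4) := by field_simp; norm_num)
    hkk (two (Nat.cast_nonneg _) s4r)
    (by
      calc n * s5 ≤ n * (q ^ 4 / (8 * m * n)) := mul_le_mul_of_nonneg_left s5u (by positivity)
        _ = q * (q ^ 3 / (8 * m)) := by field_simp)
    hn s5r (by rw [heta]; linarith)
    (ham.trans (mul_le_mul_of_nonneg_right ha (by positivity)))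
  set k1 := 8 * m * n / q ^ 5 with hk1
  have hk1pos : 0 < k1 := by positivity
  have hq5 : q ^ 5 ≤ 1 / 1024 := by
    calc q ^ 5 ≤ (1 / 4) ^ 5 := pow_le_pow_left₀ hq0.le hq4 5
      _ = _ := by norm_num
  have hk1n : 160 * n ≤ k1 := by
    rw [hk1, le_div_iff₀ (by positivity)]
    have h1 : 160 * n * q ^ 5 ≤ 160 * n * (1 / 1024) := mul_le_mul_of_nonneg_left hq5 (by positivity)
    nlinarith
  obtain ⟨nu', b1, b2, b3, b4⟩ := add_chars hnu lam k1 (80 * n) R hk1pos (by positivity) hR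
  have hdr : d + r ≤ D := by omega
  obtain ⟨s', s'l, s'u, s'r⟩ := b1.reg' hdr hD0 heta0 hM0 hq (u := 1) one_pos
  rw [mul_one] at s'r
  refine ⟨nu', d + r, b1, by omega, ?_, ?_, s', by linarith, s'u, s'r, ?_⟩
  · intro z
    have h0 := hnu.nonneg z
    refine le_trans ?_ (b2 z)
    exact le_mul_of_one_le_left h0 (by linarith)
  · intro z
    refine (b4 z).trans (max_le (le_of_eq (mul_comm _ _)) ?_)
    have h1 : k1 ≤ R * k1 := le_mul_of_one_le_left hk1pos.le hR1
    linarith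
  · obtain ⟨x', hx'⟩ := hlam (bl nu' s') ⟨0, b1.zero_mem (by linarith)⟩ (by
      intro v hv
      have hv' := (mem_bl.mp hv).trans s'u
      constructor
      · have h1 := (b2 v).trans hv'
        have e : q * (q ^ 4 / (8 * m * n)) = 1 / k1 := by rw [hk1]; field_simp
        rw [e, le_div_iff₀ hk1pos]; linarith
      · intro i
        have h1 := (b3 v i).trans hv'
        rw [le_div_iff₀ (by positivity)]; linarith)
    refine ⟨x + x', hx'.trans ?_⟩
    apply Nat.cast_le.mpr
    apply Finset.card_le_card
    intro v hv
    obtain ⟨v1, v2⟩ := Finset.mem_filter.mp hv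
    rw [Finset.mem_filter]
    refine ⟨v1, ?_⟩
    have := (Finset.mem_filter.mp v2).2
    rwa [add_assoc]

end stp

section itr
variable {G : Type} [AddCommGroup G] [Fintype G] [DecidableEq G]

lemma iter_aux (A : Finset G) (a0 eta q : ℝ) (D M0 p m k n : ℕ)
    (ha0 : 0 < a0) (heta : eta = a0 / 1000) (hM0 : 99 ≤ M0 * eta)
    (hp : Even p) (hp30 : 30 ≤ p) (hpa : 4 / a0 ≤ (1.118 : ℝ) ^ p) (hm : 0 < m) (ham : 40 ≤ a0 * 4 ^ m)
    (hk : 0 < k) (hkk : 1280 * m / (a0 ^ (6 * p) / 160) ≤ Real.exp (k / (51200 * (m : ℝ) ^ 2)))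
    (hn0 : 0 < n) (hn : 8 * (2 / (a0 ^ (6 * p) / 160)) ^ k < Real.exp (n / 32))
    (hq : q = 1 / (4 * M0 * D)) (hK : 1 ≤ 8 * m * n / q ^ 5) (i : ℕ) :
    ∀ (nu : G → ℝ) (d : ℕ), Boh nu d → d + i * n ≤ D → ∀ R : ℝ, 1 ≤ R → (∀ x, nu x ≤ R) →
    ∀ s : ℝ, 1 / 2 ≤ s → s ≤ 1 →
    ((bl nu (s + q)).card : ℝ) ≤ (1 + eta) * (bl nu s).card → ∀ (x : G) (a : ℝ), a0 ≤ a →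
    1 < a * 1.05 ^ i →
    (((bl nu s).filter (fun v => x + v ∈ A)).card : ℝ) = a * (bl nu s).card →
    ∃ (nu' : G → ℝ) (d' : ℕ), Boh nu' d' ∧ d' ≤ D ∧ (∀ x, nu x ≤ nu' x) ∧
      (∀ x, nu' x ≤ R * (8 * m * n / q ^ 5) ^ i) ∧
      ∃ g, ∀ t, nu' t ≤ q ^ 2 / 4 → g + t ∈ A + A + A := by
  induction i with
  | zero =>
    intro nu d hnu hd R hR1 hR s hs hs1 hreg x a ha hai hden
    exfalso
    have hWpos : (0 : ℝ) < (bl nu s).card := hnu.card_pos (by linarith)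
    have h1 : (((bl nu s).filter (fun v => x + v ∈ A)).card : ℝ) ≤ (bl nu s).card := by
      exact_mod_cast Finset.card_filter_le _ _
    rw [hden] at h1
    rw [pow_zero, mul_one] at hai
    nlinarith
  | succ i ih =>
    intro nu d hnu hd R hR1 hR s hs hs1 hreg x a ha hai hden
    have hd' : d + n + i * n ≤ D := by linarith [hd, add_mul i 1 n]
    have hdn : d + n ≤ D := le_trans (Nat.le_add_right _ _) hd'
    rcases step hnu A a0 eta q R D M0 p m k n ha0 heta hM0 hdn hp hp30 hpa hm ham hk hkk hn0 hn hq hR hR1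
      s hs hs1 hreg x a ha hden with ⟨g, hg⟩ | ⟨nu', d', b1, b2, b3, b4, s', b5, b6, b7, x', b8⟩
    · refine ⟨nu, d, hnu, by omega, fun _ => le_rfl, fun z => (hR z).trans ?_, g, hg⟩
      exact le_mul_of_one_le_right (by linarith) (one_le_pow₀ hK)
    · have hWpos : (0 : ℝ) < (bl nu' s').card := b1.card_pos (by linarith)
      set a' : ℝ := (((bl nu' s').filter (fun v => x' + v ∈ A)).card : ℝ) / (bl nu' s').card with ha'
      have haa : 1.05 * a ≤ a' := by rw [ha', le_div_iff₀ hWpos]; exact b8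
      obtain ⟨nu2, d2, c1, c2, c3, c4, c5⟩ := ih nu' d' b1 (by omega) (R * (8 * m * n / q ^ 5))
        (one_le_mul_of_one_le_of_one_le hR1 hK) b4 s' b5 b6 b7 x' a' (by linarith) (by
          rw [pow_succ] at hai
          have h1 : 1.05 * a * 1.05 ^ i ≤ a' * 1.05 ^ i := mul_le_mul_of_nonneg_right haa (by positivity)
          linarith) (by rw [ha']; field_simp)
      refine ⟨nu2, d2, c1, c2, fun z => (b3 z).trans (c3 z), fun z => (c4 z).trans (le_of_eq ?_), c5⟩
      rw [pow_succ]; ring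

lemma exists_dense_translate (A B : Finset G) :
    ∃ x : G, (A.card : ℝ) / Fintype.card G * B.card ≤ ((B.filter (fun v => x + v ∈ A)).card : ℝ) := by
  by_contra hcon
  push Not at hcon
  have h1 : ∑ x : G, ((B.filter (fun v => x + v ∈ A)).card : ℝ) < ∑ _x : G, (A.card : ℝ) / Fintype.card G * B.card :=
    Finset.sum_lt_sum_of_nonempty ⟨0, Finset.mem_univ _⟩ (fun x _ => hcon x)
  simp_rw [← Finset.sum_boole] at h1
  rw [Finset.sum_comm] at h1
  have h2 : ∀ v : G, ∑ x : G, (if x + v ∈ A then (1 : ℝ) else 0) = A.card := by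
    intro v
    rw [Fintype.sum_equiv (Equiv.addRight v) (fun x => if x + v ∈ A then (1 : ℝ) else 0)
      (fun x => if x ∈ A then (1 : ℝ) else 0) (fun x => rfl)]
    simp
  simp_rw [h2] at h1
  simp only [Finset.sum_const, nsmul_eq_mul, Finset.card_univ] at h1
  have hG : (0 : ℝ) < Fintype.card G := by exact_mod_cast Fintype.card_pos_iff.mpr ⟨0⟩
  have : (Fintype.card G : ℝ) * ((A.card : ℝ) / Fintype.card G * B.card) = B.card * A.card := by field_simp
  linarith

/-- Conclusion of the density increment iteration. -/
lemma iter_main {nu0 : G → ℝ} (h0 : Boh nu0 1) (hR0 : ∀ x, nu0 x ≤ 1) (A : Finset G) (a0 eta q : ℝ) (D M0 p m k n J : ℕ)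
    (ha0 : 0 < a0) (haA : a0 ≤ (A.card : ℝ) / Fintype.card G)
    (heta : eta = a0 / 1000) (hM0 : 99 ≤ M0 * eta)
    (hp : Even p) (hp30 : 30 ≤ p) (hpa : 4 / a0 ≤ (1.118 : ℝ) ^ p) (hm : 0 < m) (ham : 40 ≤ a0 * 4 ^ m)
    (hk : 0 < k) (hkk : 1280 * m / (a0 ^ (6 * p) / 160) ≤ Real.exp (k / (51200 * (m : ℝ) ^ 2)))
    (hn0 : 0 < n) (hn : 8 * (2 / (a0 ^ (6 * p) / 160)) ^ k < Real.exp (n / 32))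
    (hq : q = 1 / (4 * M0 * D)) (hK : 1 ≤ 8 * m * n / q ^ 5) (hJ : 1 < a0 * 1.05 ^ J)
    (hD : 1 + J * n ≤ D) :
    ∃ (nu' : G → ℝ) (d' : ℕ), Boh nu' d' ∧ d' ≤ D ∧ (∀ x, nu0 x ≤ nu' x) ∧
      (∀ x, nu' x ≤ (8 * m * n / q ^ 5) ^ J) ∧
      ∃ g, ∀ t, nu' t ≤ q ^ 2 / 4 → g + t ∈ A + A + A := by
  have heta0 : 0 < eta := by rw [heta]; positivity
  obtain ⟨s, s1, s2, s3⟩ := h0.reg' (D := D) (by omega) (by omega) heta0 hM0 hq (u := 1) one_pos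
  rw [mul_one] at s3
  obtain ⟨x, hx⟩ := exists_dense_translate A (bl nu0 s)
  have hWpos : (0 : ℝ) < (bl nu0 s).card := h0.card_pos (by linarith)
  set a : ℝ := (((bl nu0 s).filter (fun v => x + v ∈ A)).card : ℝ) / (bl nu0 s).card with ha
  have haa : a0 ≤ a := by
    refine haA.trans ?_
    rw [ha, le_div_iff₀ hWpos]; exact hx
  have := iter_aux A a0 eta q D M0 p m k n ha0 heta hM0 hp hp30 hpa hm ham hk hkk hn0 hn hq hK J nu0 1 h0 hD 1 le_rfl hR0
    s (by linarith) s2 s3 x a haa (hJ.trans_le (mul_le_mul_of_nonneg_right haa (by positivity)))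
    (by rw [ha]; field_simp)
  simpa using this

end itr

section zm

/-- The base seminorm on `ZMod M`. -/
def nz (M : ℕ) (x : ZMod M) : ℝ := |(x.valMinAbs : ℝ)| / M

lemma natAbs_vma_le (M : ℕ) [NeZero M] (a : ℤ) : ((a : ZMod M).valMinAbs).natAbs ≤ a.natAbs := by
  have h := (ZMod.valMinAbs_mem_Ioc (a : ZMod M))
  have h2 : (((a : ZMod M).valMinAbs : ℤ) : ZMod M) = a := ZMod.coe_valMinAbs _
  apply ZMod.natAbs_min_of_le_div_two M _ _ h2
  exact ZMod.natAbs_valMinAbs_le _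

lemma nz_le (M : ℕ) [NeZero M] (x : ZMod M) (a : ℤ) (h : x = (a : ZMod M)) : nz M x ≤ |(a : ℝ)| / M := by
  have h1 := natAbs_vma_le M a
  rw [← h] at h1
  have h2 : |(x.valMinAbs : ℤ)| ≤ |a| := by
    rw [Int.abs_eq_natAbs, Int.abs_eq_natAbs]; exact_mod_cast h1
  unfold nz
  apply div_le_div_of_nonneg_right _ (Nat.cast_nonneg _)
  exact_mod_cast h2

lemma nz_boh (M : ℕ) [NeZero M] : Boh (nz M) 1 := by
  have hM : (0 : ℝ) < M := by exact_mod_cast Nat.pos_of_ne_zero (NeZero.ne M)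
  refine ⟨by simp [nz], ?_, ?_, ?_⟩
  · intro x
    apply le_antisymm
    · have := nz_le M (-x) (-x.valMinAbs) (by simp)
      refine this.trans ?_
      simp [nz]
    · have := nz_le M x (-(-x).valMinAbs) (by simp)
      refine this.trans ?_
      simp [nz]
  · intro x y
    have := nz_le M (x + y) (x.valMinAbs + y.valMinAbs) (by simp)
    refine this.trans ?_
    unfold nz
    rw [← add_div]
    apply div_le_div_of_nonneg_right _ hM.le
    push_cast
    exact abs_add_le _ _
  · intro s hs
    refine ⟨ZMod 5, inferInstance, fun x => ((⌊(x.valMinAbs : ℝ) / (M * s)⌋ : ℤ) : ZMod 5), by rw [ZMod.card]; norm_num, ?_⟩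
    intro x y hx hy hxy
    have hMs : 0 < M * s := by positivity
    have key : ∀ z : ZMod M, nz M z ≤ 2 * s → -2 ≤ ⌊(z.valMinAbs : ℝ) / (M * s)⌋ ∧ ⌊(z.valMinAbs : ℝ) / (M * s)⌋ ≤ 2 := by
      intro z hz
      unfold nz at hz
      rw [div_le_iff₀ hM] at hz
      have hz2 := abs_le.mp hz
      constructor
      · rw [Int.le_floor, le_div_iff₀ hMs]; push_cast; linarith
      · have : (⌊(z.valMinAbs : ℝ) / (M * s)⌋ : ℝ) ≤ 2 := by
          refine (Int.floor_le _).trans ?_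
          rw [div_le_iff₀ hMs]; linarith
        exact_mod_cast this
    have kx := key x hx
    have ky := key y hy
    have hfl : ⌊(x.valMinAbs : ℝ) / (M * s)⌋ = ⌊(y.valMinAbs : ℝ) / (M * s)⌋ := by
      have := (ZMod.intCast_eq_intCast_iff_dvd_sub _ _ 5).mp hxy
      omega
    have h1 := Int.abs_sub_lt_one_of_floor_eq_floor hfl
    rw [← sub_div, abs_div, abs_of_pos hMs, div_lt_one hMs] at h1
    have := nz_le M (x - y) (x.valMinAbs - y.valMinAbs) (by simp)
    refine this.trans ?_
    rw [div_le_iff₀ hM]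
    push_cast
    linarith

lemma nz_le_one (M : ℕ) [NeZero M] (x : ZMod M) : nz M x ≤ 1 := by
  have hM : (0 : ℝ) < M := by exact_mod_cast Nat.pos_of_ne_zero (NeZero.ne M)
  unfold nz
  rw [div_le_one hM]
  have h1 := ZMod.natAbs_valMinAbs_le x
  have h2 : x.valMinAbs.natAbs ≤ M := h1.trans (Nat.div_le_self _ _)
  have h3 : |x.valMinAbs| ≤ (M : ℤ) := by rw [Int.abs_eq_natAbs]; exact_mod_cast h2
  exact_mod_cast h3

lemma find_small {G : Type} [AddCommGroup G] [Fintype G] [DecidableEq G] {nu : G → ℝ} {d : ℕ} (h : Boh nu d)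
    {D : ℕ} (hd : d ≤ D) {R t : ℝ} (hR : ∀ x, nu x ≤ R) (ht : 0 < t) (kk : ℕ) (hkk : R ≤ 2 ^ kk * t)
    (hG : 100 ^ (D * kk) < Fintype.card G) : ∃ d0 : G, d0 ≠ 0 ∧ nu d0 ≤ t := by
  by_contra hcon
  push Not at hcon
  have h1 := h.doubling_iter ht kk
  have h2 : bl nu (2 ^ kk * t) = Finset.univ := by
    ext z; simp only [mem_bl, Finset.mem_univ, iff_true]; exact (hR z).trans hkk
  have h3 : bl nu t ⊆ {0} := by
    intro z hz
    rw [Finset.mem_singleton]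
    by_contra hz0
    exact absurd (mem_bl.mp hz) (not_le.mpr (hcon z hz0))
  have h4 : (bl nu t).card ≤ 1 := by simpa using Finset.card_le_card h3
  rw [h2, Finset.card_univ] at h1
  have h5 : 100 ^ (d * kk) ≤ 100 ^ (D * kk) := Nat.pow_le_pow_right (by norm_num) (Nat.mul_le_mul_right _ hd)
  have h6 : 100 ^ (d * kk) * (bl nu t).card ≤ 100 ^ (D * kk) * 1 := Nat.mul_le_mul h5 h4
  omega

lemma Boh.nsmul_le {G : Type} [AddCommGroup G] [Fintype G] [DecidableEq G] {nu : G → ℝ} {d : ℕ} (h : Boh nu d) (x : G) (i : ℕ) :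
    nu (i • x) ≤ i * nu x := by
  induction i with
  | zero => simp [h.zero]
  | succ i ih =>
    rw [succ_nsmul]
    have := h.add (i • x) x
    push_cast
    linarith

lemma lift_ap (N : ℕ) (A0 : Finset ℕ) (hA : A0 ⊆ Finset.Icc 1 N) (hN : 0 < N) (g d0 : ZMod (8 * N)) (hd0 : d0 ≠ 0)
    (L : ℕ) (hL : 0 < L) (hsm : nz (8 * N) d0 ≤ 1 / 64)
    (h : ∀ i < L, g + i • d0 ∈ A0.image (Nat.cast : ℕ → ZMod (8 * N)) + A0.image (Nat.cast : ℕ → ZMod (8 * N)) +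
      A0.image (Nat.cast : ℕ → ZMod (8 * N))) :
    ∃ a d : ℕ, 0 < d ∧ ∀ i < L, a + i * d ∈ A0 + A0 + A0 := by
  haveI : NeZero (8 * N) := ⟨by omega⟩
  have hw : ∀ i : ℕ, ∃ w : ℕ, i < L → (w ∈ A0 + A0 + A0 ∧ w ≤ 3 * N ∧ (w : ZMod (8 * N)) = g + i • d0) := by
    intro i
    by_cases hi : i < L
    · have := h i hi
      rw [Finset.mem_add] at this
      obtain ⟨u, hu, v, hv, huv⟩ := this
      obtain ⟨u1, hu1, u2, hu2, huu⟩ := Finset.mem_add.mp hu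
      obtain ⟨x, hx, rfl⟩ := Finset.mem_image.mp hu1
      obtain ⟨y, hy, rfl⟩ := Finset.mem_image.mp hu2
      obtain ⟨z, hz, rfl⟩ := Finset.mem_image.mp hv
      refine ⟨x + y + z, fun _ => ⟨Finset.add_mem_add (Finset.add_mem_add hx hy) hz, ?_, ?_⟩⟩
      · have a1 := (Finset.mem_Icc.mp (hA hx)).2
        have a2 := (Finset.mem_Icc.mp (hA hy)).2
        have a3 := (Finset.mem_Icc.mp (hA hz)).2
        omega
      · push_cast; rw [huu, huv]
    · exact ⟨0, fun hh => absurd hh hi⟩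
  choose w hw using hw
  set e : ℤ := d0.valMinAbs with he
  have he0 : e ≠ 0 := by
    intro h0
    exact hd0 ((ZMod.valMinAbs_eq_zero d0).mp h0)
  have hee : ((e : ℤ) : ZMod (8 * N)) = d0 := ZMod.coe_valMinAbs _
  have hes : |e| ≤ N := by
    unfold nz at hsm
    have hNp : (0 : ℝ) < N := by exact_mod_cast hN
    rw [div_le_iff₀ (by push_cast; positivity)] at hsm
    have : |(e : ℝ)| ≤ N := by push_cast at hsm; linarith
    exact_mod_cast this
  have hstep : ∀ i, i < L → (w i : ℤ) = w 0 + i * e := by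
    intro i
    induction i with
    | zero => intro _; simp
    | succ i ih =>
      intro hi
      have h1 := ih (by omega)
      obtain ⟨_, b2, b3⟩ := hw (i + 1) hi
      obtain ⟨_, c2, c3⟩ := hw i (by omega)
      have h2 : (((w i : ℤ) + e : ℤ) : ZMod (8 * N)) = ((w (i + 1) : ℤ) : ZMod (8 * N)) := by
        push_cast
        rw [b3, c3, hee, succ_nsmul, add_assoc]
      rw [ZMod.intCast_eq_intCast_iff_dvd_sub] at h2
      have h3 : (w (i + 1) : ℤ) - (w i + e) = 0 := by
        apply Int.eq_zero_of_abs_lt_dvd h2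
        have := abs_le.mp hes
        rw [abs_lt]
        push_cast
        omega
      push_cast
      linarith
  rcases lt_or_gt_of_ne he0 with hneg | hpos
  · refine ⟨w (L - 1), (-e).toNat, by omega, fun i hi => ?_⟩
    have h1 := hstep (L - 1) (by omega)
    have h2 := hstep (L - 1 - i) (by omega)
    have h3 : w (L - 1) + i * (-e).toNat = w (L - 1 - i) := by
      zify
      rw [Int.toNat_of_nonneg (by omega), h1, h2]
      have : ((L - 1 : ℕ) : ℤ) = ((L - 1 - i : ℕ) : ℤ) + i := by omega
      rw [this]; ring
    rw [h3]
    exact (hw _ (by omega)).1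
  · refine ⟨w 0, e.toNat, by omega, fun i hi => ?_⟩
    have h2 := hstep i hi
    have h3 : w 0 + i * e.toNat = w i := by
      zify
      rw [Int.toNat_of_nonneg (by omega), h2]
    rw [h3]
    exact (hw _ hi).1

lemma ap_param (N : ℕ) (A0 : Finset ℕ) (hA : A0 ⊆ Finset.Icc 1 N) (hN : 0 < N) (a0 eta q : ℝ) (D M0 p m k n J : ℕ)
    (ha0 : 0 < a0) (haA : a0 ≤ (A0.card : ℝ) / (8 * N))
    (heta : eta = a0 / 1000) (hM0 : 99 ≤ M0 * eta)
    (hp : Even p) (hp30 : 30 ≤ p) (hpa : 4 / a0 ≤ (1.118 : ℝ) ^ p) (hm : 0 < m) (ham : 40 ≤ a0 * 4 ^ m)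
    (hk : 0 < k) (hkk : 1280 * m / (a0 ^ (6 * p) / 160) ≤ Real.exp (k / (51200 * (m : ℝ) ^ 2)))
    (hn0 : 0 < n) (hn : 8 * (2 / (a0 ^ (6 * p) / 160)) ^ k < Real.exp (n / 32))
    (hq : q = 1 / (4 * M0 * D)) (hq0 : 0 < q) (hq4 : q ≤ 1 / 4) (hK : 1 ≤ 8 * m * n / q ^ 5) (hJ : 1 < a0 * 1.05 ^ J)
    (hD : 1 + J * n ≤ D) (L kk : ℕ) (hL : 0 < L) (hkL : (8 * m * n / q ^ 5) ^ J ≤ 2 ^ kk * (q ^ 2 / 4 / L))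
    (hNk : 100 ^ (D * kk) < 8 * N) :
    ∃ a d : ℕ, 0 < d ∧ ∀ i < L, a + i * d ∈ A0 + A0 + A0 := by
  haveI : NeZero (8 * N) := ⟨by omega⟩
  set A := A0.image (Nat.cast : ℕ → ZMod (8 * N)) with hAdef
  have hcard : A.card = A0.card := by
    apply Finset.card_image_of_injOn
    intro x hx y hy hxy
    have a1 := (Finset.mem_Icc.mp (hA hx)).2
    have a2 := (Finset.mem_Icc.mp (hA hy)).2
    have := (ZMod.natCast_eq_natCast_iff' _ _ _).mp hxy
    rwa [Nat.mod_eq_of_lt (by omega), Nat.mod_eq_of_lt (by omega)] at this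
  obtain ⟨nu, d, b1, b2, b3, b4, g, hg⟩ := iter_main (nz_boh (8 * N)) (nz_le_one (8 * N)) A a0 eta q D M0 p m k n J ha0
    (by rw [hcard, ZMod.card]; push_cast; exact haA) heta hM0 hp hp30 hpa hm ham hk hkk hn0 hn hq hK hJ hD
  have hLp : (0 : ℝ) < L := by exact_mod_cast hL
  obtain ⟨d0, hd0, hd1⟩ := find_small b1 b2 b4 (t := q ^ 2 / 4 / L) (by positivity) kk hkL (by rwa [ZMod.card])
  have hL1 : (1 : ℝ) ≤ L := by exact_mod_cast hL
  apply lift_ap N A0 hA hN g d0 hd0 L hL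
  · refine (b3 d0).trans (hd1.trans ?_)
    rw [div_le_iff₀ hLp]
    nlinarith
  · intro i hi
    apply hg
    refine (b1.nsmul_le d0 i).trans ?_
    have hi' : (i : ℝ) ≤ L := by exact_mod_cast hi.le
    calc (i : ℝ) * nu d0 ≤ L * nu d0 := mul_le_mul_of_nonneg_right hi' (b1.nonneg d0)
      _ ≤ L * (q ^ 2 / 4 / L) := mul_le_mul_of_nonneg_left hd1 hLp.le
      _ = _ := by field_simp

end zm

section fin

lemma le_exp_nat (n : ℕ) : (2.7 : ℝ) ^ n ≤ Real.exp n := by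
  rw [← Real.exp_one_pow]
  exact pow_le_pow_left₀ (by norm_num) (by linarith [Real.exp_one_gt_d9]) n

lemma exp_nat_le (b : ℝ) (r T : ℕ) (h : (2.7182818286 : ℝ) ≤ b ^ r) : Real.exp T ≤ b ^ (r * T) := by
  rw [← Real.exp_one_pow, pow_mul]
  exact pow_le_pow_left₀ (Real.exp_pos _).le (by linarith [Real.exp_one_lt_d9]) T

set_option maxHeartbeats 2000000 in
lemma ap_T (N : ℕ) (A0 : Finset ℕ) (hA : A0 ⊆ Finset.Icc 1 N) (hN : 0 < N) (a0 : ℝ) (T : ℕ) (hT : 0 < T)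
    (ha0 : Real.exp (-(3 * T)) ≤ a0) (ha01 : a0 ≤ 1) (haA : a0 ≤ (A0.card : ℝ) / (8 * N))
    (L kk : ℕ) (hL : 0 < L) (hkL : Real.exp (30000 * (T : ℝ) ^ 2) * L ≤ 2 ^ kk)
    (hNk : 100 ^ (8256962560000000 * T ^ 7 * kk) < 8 * N) :
    ∃ a d : ℕ, 0 < d ∧ ∀ i < L, a + i * d ∈ A0 + A0 + A0 := by
  have hT1 : (1 : ℝ) ≤ T := by exact_mod_cast hT
  have hT2 : (T : ℝ) ≤ (T : ℝ) ^ 2 := by nlinarith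
  have ha0p : 0 < a0 := (Real.exp_pos _).trans_le ha0
  have hinv : 1 / a0 ≤ Real.exp (3 * T) := by
    rw [div_le_iff₀ ha0p]
    have := mul_le_mul_of_nonneg_left ha0 (Real.exp_pos (3 * (T : ℝ))).le
    rwa [← Real.exp_add, add_neg_cancel, Real.exp_zero] at this
  have hTe : (T : ℝ) ≤ Real.exp T := by linarith [Real.add_one_le_exp (T : ℝ)]
  obtain ⟨k, hkdef⟩ : ∃ k : ℕ, k = 2759680000 * T ^ 4 := ⟨_, rfl⟩
  obtain ⟨n, hndef⟩ : ∃ n : ℕ, n = 35200 * T ^ 2 * k := ⟨_, rfl⟩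
  obtain ⟨D, hDdef⟩ : ∃ D : ℕ, D = 85 * T * n := ⟨_, rfl⟩
  obtain ⟨M0, hM0def⟩ : ∃ M : ℕ, M = ⌈99000 / a0⌉₊ := ⟨_, rfl⟩
  have hk0 : 0 < k := by rw [hkdef]; positivity
  have hn0 : 0 < n := by rw [hndef]; positivity
  have hD0 : 0 < D := by rw [hDdef]; positivity
  have hkR : (k : ℝ) = 2759680000 * (T : ℝ) ^ 4 := by rw [hkdef]; push_cast; ring
  have hnR : (n : ℝ) = 97140736000000 * (T : ℝ) ^ 6 := by rw [hndef]; push_cast; rw [hkR]; ring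
  have hDR : (D : ℝ) = 8256962560000000 * (T : ℝ) ^ 7 := by rw [hDdef]; push_cast; rw [hnR]; ring
  have hDN : D = 8256962560000000 * T ^ 7 := by exact_mod_cast hDR
  have hM1 : 99000 / a0 ≤ M0 := by rw [hM0def]; exact Nat.le_ceil _
  have hia : 1 ≤ 1 / a0 := by rw [le_div_iff₀ ha0p]; linarith
  have hM2 : (M0 : ℝ) ≤ 100000 * Real.exp (3 * T) := by
    have h1 : (M0 : ℝ) < 99000 / a0 + 1 := by rw [hM0def]; exact Nat.ceil_lt_add_one (by positivity)
    have h2 : 99000 / a0 = 99000 * (1 / a0) := by ring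
    linarith
  have hM0p : (0 : ℝ) < M0 := lt_of_lt_of_le (by positivity) hM1
  have hM01 : (1 : ℝ) ≤ M0 := by
    have : 0 < M0 := by exact_mod_cast hM0p
    exact_mod_cast this
  have hD1 : (1 : ℝ) ≤ D := by exact_mod_cast hD0
  obtain ⟨q, hq⟩ : ∃ q : ℝ, q = 1 / (4 * M0 * D) := ⟨_, rfl⟩
  have hq0 : 0 < q := by rw [hq]; positivity
  have hq4 : q ≤ 1 / 4 := by
    rw [hq]
    apply one_div_le_one_div_of_le (by norm_num)
    nlinarith [mul_nonneg (by linarith : (0:ℝ) ≤ M0 - 1) (by linarith : (0:ℝ) ≤ D - 1)]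
  have hqi : 1 / q ≤ Real.exp (60 * T) := by
    have e : 1 / q = 4 * M0 * D := by rw [hq]; simp
    rw [e, hDR]
    have h7 : (T : ℝ) ^ 7 ≤ Real.exp (7 * T) := by
      calc (T : ℝ) ^ 7 ≤ Real.exp T ^ 7 := pow_le_pow_left₀ (by positivity) hTe 7
        _ = _ := by rw [← Real.exp_nat_mul]; norm_num
    have h50 := le_exp_nat 50
    have hnum : (4 * 100000 * 8256962560000000 : ℝ) ≤ Real.exp 50 := le_trans (by norm_num) h50
    calc (4 : ℝ) * M0 * (8256962560000000 * (T : ℝ) ^ 7)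
        ≤ 4 * (100000 * Real.exp (3 * T)) * (8256962560000000 * Real.exp (7 * T)) := by gcongr
      _ = (4 * 100000 * 8256962560000000) * (Real.exp (3 * T) * Real.exp (7 * T)) := by ring
      _ ≤ Real.exp 50 * (Real.exp (3 * T) * Real.exp (7 * T)) := by gcongr
      _ = Real.exp (50 + (3 * T + 7 * T)) := by rw [Real.exp_add, Real.exp_add]
      _ ≤ _ := Real.exp_le_exp.mpr (by linarith)
  -- the density of the sifted set
  have hdel : 1 / (a0 ^ (6 * (60 * T)) / 160) ≤ Real.exp (1086 * (T : ℝ) ^ 2) := by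
    have e : 1 / (a0 ^ (6 * (60 * T)) / 160) = 160 * (1 / a0) ^ (360 * T) := by
      rw [one_div_pow, show 6 * (60 * T) = 360 * T by ring]; field_simp
    rw [e]
    have h6 : (160 : ℝ) ≤ Real.exp 6 := le_trans (by norm_num) (le_exp_nat 6)
    calc (160 : ℝ) * (1 / a0) ^ (360 * T) ≤ Real.exp 6 * Real.exp (3 * T) ^ (360 * T) := by gcongr
      _ = Real.exp (6 + 1080 * (T : ℝ) ^ 2) := by
          rw [← Real.exp_nat_mul, ← Real.exp_add]; congr 1; push_cast; ring
      _ ≤ _ := Real.exp_le_exp.mpr (by linarith)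
  have hdp : 0 < a0 ^ (6 * (60 * T)) / 160 := by positivity
  have hK1 : 1 ≤ 8 * ((7 * T : ℕ) : ℝ) * n / q ^ 5 := by
    rw [le_div_iff₀ (by positivity)]
    have h1 : q ^ 5 ≤ 1 := pow_le_one₀ hq0.le (by linarith)
    have h2 : (1 : ℝ) ≤ n := by exact_mod_cast hn0
    push_cast
    nlinarith [mul_le_mul hT1 h2 zero_le_one (by linarith)]
  have hKe : 8 * ((7 * T : ℕ) : ℝ) * n / q ^ 5 ≤ Real.exp (350 * T) := by
    have e : 8 * ((7 * T : ℕ) : ℝ) * n / q ^ 5 = (56 * 97140736000000) * (T : ℝ) ^ 7 * (1 / q) ^ 5 := by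
      rw [hnR, one_div_pow]; push_cast; field_simp; norm_num
    rw [e]
    have hnum : (56 * 97140736000000 : ℝ) ≤ Real.exp 40 := le_trans (by norm_num) (le_exp_nat 40)
    calc (56 * 97140736000000) * (T : ℝ) ^ 7 * (1 / q) ^ 5
        ≤ Real.exp 40 * Real.exp T ^ 7 * Real.exp (60 * T) ^ 5 := by gcongr
      _ = Real.exp (40 + 7 * T + 300 * T) := by
          rw [← Real.exp_nat_mul, ← Real.exp_nat_mul, ← Real.exp_add, ← Real.exp_add]; congr 1; push_cast; ring
      _ ≤ _ := Real.exp_le_exp.mpr (by linarith)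
  have hLp : (0 : ℝ) < L := by exact_mod_cast hL
  refine ap_param N A0 hA hN a0 (a0 / 1000) q D M0 (60 * T) (7 * T) k n (84 * T) ha0p haA rfl ?_ ?_ (by omega) ?_
    (by omega) ?_ hk0 ?_ hn0 ?_ hq hq0 hq4 hK1 ?_ ?_ L kk hL ?_ ?_
  · rw [div_le_iff₀ ha0p] at hM1
    linarith
  · exact ⟨30 * T, by ring⟩
  · have h1 := exp_nat_le 1.118 10 (6 * T) (by norm_num)
    rw [show 10 * (6 * T) = 60 * T by ring] at h1
    refine le_trans ?_ h1
    have h4 : (4 : ℝ) ≤ Real.exp 2 := le_trans (by norm_num) (le_exp_nat 2)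
    calc 4 / a0 = 4 * (1 / a0) := by ring
      _ ≤ Real.exp 2 * Real.exp (3 * T) := by gcongr
      _ = Real.exp (2 + 3 * T) := by rw [Real.exp_add]
      _ ≤ _ := Real.exp_le_exp.mpr (by push_cast; linarith)
  · have h1 := exp_nat_le 4 1 (7 * T) (by norm_num)
    rw [one_mul] at h1
    have h4 : (40 : ℝ) ≤ Real.exp 4 := le_trans (by norm_num) (le_exp_nat 4)
    calc (40 : ℝ) ≤ Real.exp (-(3 * T) + (4 + 3 * T)) := by
          rw [show -(3 * (T : ℝ)) + (4 + 3 * T) = 4 by ring]; exact h4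
      _ = Real.exp (-(3 * T)) * Real.exp (4 + 3 * T) := Real.exp_add _ _
      _ ≤ a0 * Real.exp ((7 * T : ℕ) : ℝ) := by
          apply mul_le_mul ha0 _ (Real.exp_pos _).le ha0p.le
          exact Real.exp_le_exp.mpr (by push_cast; linarith)
      _ ≤ _ := mul_le_mul_of_nonneg_left h1 ha0p.le
  · have e : (k : ℝ) / (51200 * ((7 * T : ℕ) : ℝ) ^ 2) = 1100 * (T : ℝ) ^ 2 := by
      rw [hkR]; push_cast; field_simp; norm_num
    rw [e]
    have h10 : (8960 : ℝ) ≤ Real.exp 10 := le_trans (by norm_num) (le_exp_nat 10)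
    calc 1280 * ((7 * T : ℕ) : ℝ) / (a0 ^ (6 * (60 * T)) / 160)
        = 8960 * T * (1 / (a0 ^ (6 * (60 * T)) / 160)) := by push_cast; ring
      _ ≤ Real.exp 10 * Real.exp T * Real.exp (1086 * (T : ℝ) ^ 2) := by gcongr
      _ = Real.exp (10 + T + 1086 * (T : ℝ) ^ 2) := by rw [Real.exp_add, Real.exp_add]
      _ ≤ _ := Real.exp_le_exp.mpr (by linarith)
  · have h8 : (8 : ℝ) < Real.exp 3 := lt_of_lt_of_le (by norm_num) (le_exp_nat 3)
    have h2 : (2 : ℝ) ≤ Real.exp 1 := by linarith [Real.exp_one_gt_d9]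
    have hb : 2 / (a0 ^ (6 * (60 * T)) / 160) ≤ Real.exp (1087 * (T : ℝ) ^ 2) := by
      calc 2 / (a0 ^ (6 * (60 * T)) / 160) = 2 * (1 / (a0 ^ (6 * (60 * T)) / 160)) := by ring
        _ ≤ Real.exp 1 * Real.exp (1086 * (T : ℝ) ^ 2) := by gcongr
        _ = Real.exp (1 + 1086 * (T : ℝ) ^ 2) := by rw [Real.exp_add]
        _ ≤ _ := Real.exp_le_exp.mpr (by linarith)
    have hk1 : (1 : ℝ) ≤ k := by exact_mod_cast hk0
    calc 8 * (2 / (a0 ^ (6 * (60 * T)) / 160)) ^ k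
        < Real.exp 3 * (2 / (a0 ^ (6 * (60 * T)) / 160)) ^ k := by
          apply mul_lt_mul_of_pos_right h8; positivity
      _ ≤ Real.exp 3 * Real.exp (1087 * (T : ℝ) ^ 2) ^ k := by gcongr
      _ = Real.exp (3 + k * (1087 * (T : ℝ) ^ 2)) := by rw [← Real.exp_nat_mul, ← Real.exp_add]
      _ ≤ _ := Real.exp_le_exp.mpr (by
          rw [hndef]; push_cast
          nlinarith [mul_le_mul hk1 (hT1.trans hT2) zero_le_one (by linarith)])
  · have h1 := exp_nat_le 1.05 21 (4 * T) (by norm_num)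
    rw [show 21 * (4 * T) = 84 * T by ring] at h1
    calc (1 : ℝ) < Real.exp (-(3 * T) + ((4 * T : ℕ) : ℝ)) := by
          apply Real.one_lt_exp_iff.mpr; push_cast; linarith
      _ = Real.exp (-(3 * T)) * Real.exp ((4 * T : ℕ) : ℝ) := Real.exp_add _ _
      _ ≤ a0 * 1.05 ^ (84 * T) := mul_le_mul ha0 h1 (Real.exp_pos _).le ha0p.le
  · have : 1 ≤ T * n := Nat.mul_pos hT hn0
    rw [hDdef, show 85 * T * n = T * n + 84 * T * n by ring]
    exact Nat.add_le_add_right this _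
  · have h1 : (8 * ((7 * T : ℕ) : ℝ) * n / q ^ 5) ^ (84 * T) ≤ Real.exp (29400 * (T : ℝ) ^ 2) := by
      calc (8 * ((7 * T : ℕ) : ℝ) * n / q ^ 5) ^ (84 * T) ≤ Real.exp (350 * T) ^ (84 * T) :=
            pow_le_pow_left₀ (by linarith) hKe _
        _ = _ := by rw [← Real.exp_nat_mul]; congr 1; push_cast; ring
    refine h1.trans ?_
    have h4 : (4 : ℝ) ≤ Real.exp 2 := le_trans (by norm_num) (le_exp_nat 2)
    have h5 : Real.exp (29400 * (T : ℝ) ^ 2) * 4 * (1 / q) ^ 2 ≤ Real.exp (30000 * (T : ℝ) ^ 2) := by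
      calc Real.exp (29400 * (T : ℝ) ^ 2) * 4 * (1 / q) ^ 2
          ≤ Real.exp (29400 * (T : ℝ) ^ 2) * Real.exp 2 * Real.exp (60 * T) ^ 2 := by gcongr
        _ = Real.exp (29400 * (T : ℝ) ^ 2 + 2 + 120 * T) := by
            rw [← Real.exp_nat_mul, ← Real.exp_add, ← Real.exp_add]; congr 1; push_cast; ring
        _ ≤ _ := Real.exp_le_exp.mpr (by linarith)
    have h6 : Real.exp (29400 * (T : ℝ) ^ 2) * 4 * (1 / q) ^ 2 * L ≤ 2 ^ kk :=
      (mul_le_mul_of_nonneg_right h5 hLp.le).trans hkL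
    calc Real.exp (29400 * (T : ℝ) ^ 2)
        = (Real.exp (29400 * (T : ℝ) ^ 2) * 4 * (1 / q) ^ 2 * L) * (q ^ 2 / 4 / L) := by field_simp
      _ ≤ _ := mul_le_mul_of_nonneg_right h6 (by positivity)
  · rw [hDN]; exact hNk

theorem long_ap_core :
    ∃ C c : ℝ, 0 < C ∧ 0 < c ∧
      ∀ N : ℕ, 0 < N → ∀ A ⊆ Finset.Icc 1 N, A.Nonempty →
        ∀ α : ℝ, α = (A.card : ℝ) / N →
          ∃ (a d L : ℕ), 0 < d ∧
            Real.exp (-C * Real.log (2 / α) ^ 2) * (N : ℝ) ^ (c / Real.log (2 / α) ^ 7) ≤ (L : ℝ) ∧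
            ∀ i < L, a + i * d ∈ A + A + A := by
  refine ⟨300000, 1 / 10 ^ 21, by norm_num, by norm_num, ?_⟩
  intro N hN A hA hAne α hα
  have hNp : (0 : ℝ) < N := by exact_mod_cast hN
  have hN1 : (1 : ℝ) ≤ N := by exact_mod_cast hN
  have hAp : (0 : ℝ) < A.card := by exact_mod_cast hAne.card_pos
  have hα0 : 0 < α := by rw [hα]; positivity
  have hα1 : α ≤ 1 := by
    rw [hα, div_le_one hNp]
    have := Finset.card_le_card hA
    rw [Nat.card_Icc] at this
    exact_mod_cast this
  obtain ⟨l, hl⟩ : ∃ l : ℝ, l = Real.log (2 / α) := ⟨_, rfl⟩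
  rw [← hl]
  have hl2 : Real.log 2 ≤ l := by
    rw [hl]
    apply Real.log_le_log (by norm_num)
    rw [le_div_iff₀ hα0]; linarith
  have hl69 : 0.69 ≤ l := by linarith [Real.log_two_gt_d9]
  have hl0 : 0 < l := by linarith
  have hel : Real.exp (-l) = α / 2 := by
    rw [hl, Real.exp_neg, Real.exp_log (by positivity)]; field_simp
  obtain ⟨T, hTdef⟩ : ∃ T : ℕ, T = ⌈l⌉₊ := ⟨_, rfl⟩
  have hTl : l ≤ T := by rw [hTdef]; exact Nat.le_ceil _
  have hTu : (T : ℝ) ≤ 3 * l := by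
    have : (T : ℝ) < l + 1 := by rw [hTdef]; exact Nat.ceil_lt_add_one hl0.le
    linarith
  have hT0 : 0 < T := by
    have : (0 : ℝ) < T := by linarith
    exact_mod_cast this
  have hT1 : (1 : ℝ) ≤ T := by exact_mod_cast hT0
  obtain ⟨X, hX⟩ : ∃ X : ℝ, X = Real.exp (-300000 * l ^ 2) * (N : ℝ) ^ ((1 / 10 ^ 21) / l ^ 7) := ⟨_, rfl⟩
  rw [← hX]
  have hXp : 0 < X := by rw [hX]; positivity
  by_cases hX1 : X ≤ 1
  · obtain ⟨z, hz⟩ := hAne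
    refine ⟨z + z + z, 1, 1, one_pos, by simpa using hX1, ?_⟩
    intro i hi
    have : i = 0 := by omega
    subst this
    simpa using Finset.add_mem_add (Finset.add_mem_add hz hz) hz
  push Not at hX1
  obtain ⟨L, hLdef⟩ : ∃ L : ℕ, L = ⌈X⌉₊ := ⟨_, rfl⟩
  have hLX : X ≤ L := by rw [hLdef]; exact Nat.le_ceil _
  have hL2 : (L : ℝ) ≤ 2 * X := by
    have : (L : ℝ) < X + 1 := by rw [hLdef]; exact Nat.ceil_lt_add_one hXp.le
    linarith
  have hLp : (0 : ℝ) < L := by linarith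
  have hL0 : 0 < L := by exact_mod_cast hLp
  have hlogL : Real.log L ≤ 1 + Real.log X := by
    calc Real.log L ≤ Real.log (2 * X) := Real.log_le_log hLp hL2
      _ = Real.log 2 + Real.log X := Real.log_mul (by norm_num) hXp.ne'
      _ ≤ _ := by linarith [Real.log_two_lt_d9]
  have hlogL0 : 0 ≤ Real.log L := Real.log_nonneg (by linarith)
  have hlogX : Real.log X = -300000 * l ^ 2 + (1 / 10 ^ 21) / l ^ 7 * Real.log N := by
    rw [hX, Real.log_mul (Real.exp_pos _).ne' (by positivity), Real.log_exp, Real.log_rpow hNp]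
  obtain ⟨kk, hkdef⟩ : ∃ kk : ℕ, kk = ⌈2 * (30000 * (T : ℝ) ^ 2 + Real.log L)⌉₊ := ⟨_, rfl⟩
  have hk1 : 2 * (30000 * (T : ℝ) ^ 2 + Real.log L) ≤ kk := by rw [hkdef]; exact Nat.le_ceil _
  have hk2 : (kk : ℝ) ≤ 2 * (30000 * (T : ℝ) ^ 2 + Real.log L) + 1 := by
    rw [hkdef]; exact (Nat.ceil_lt_add_one (by positivity)).le
  have hlogN : 0 ≤ Real.log N := Real.log_nonneg hN1
  have hTT : (T : ℝ) ^ 2 ≤ 9 * l ^ 2 := by nlinarith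
  have hk3 : (kk : ℝ) ≤ 2 * ((1 / 10 ^ 21) / l ^ 7 * Real.log N) := by
    have : (1 : ℝ) ≤ (T : ℝ) ^ 2 := one_le_pow₀ hT1
    linarith
  have hT7 : (T : ℝ) ^ 7 ≤ 2187 * l ^ 7 := by
    calc (T : ℝ) ^ 7 ≤ (3 * l) ^ 7 := pow_le_pow_left₀ (by positivity) hTu 7
      _ = _ := by ring
  obtain ⟨a, d, hd, had⟩ := ap_T N A hA hN (α / 8) T hT0 (by
      have h1 : Real.exp (-(3 * T)) ≤ Real.exp (-l - 2) * 1 := by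
        rw [mul_one]
        exact Real.exp_le_exp.mpr (by linarith)
      have h2 : Real.exp (-l - 2) = α / 2 * Real.exp (-2) := by rw [← hel, ← Real.exp_add]; ring_nf
      have h3 : Real.exp (-2) ≤ 1 / 4 := by
        rw [Real.exp_neg, ← one_div]
        exact one_div_le_one_div_of_le (by norm_num) (le_trans (by norm_num) (le_exp_nat 2))
      nlinarith) (by linarith) (by rw [hα]; apply le_of_eq; field_simp) L kk hL0 (by
      have h1 : Real.exp (30000 * (T : ℝ) ^ 2) * L = Real.exp (30000 * (T : ℝ) ^ 2 + Real.log L) := by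
        rw [Real.exp_add, Real.exp_log hLp]
      rw [h1, ← Real.exp_log (by norm_num : (0 : ℝ) < 2), ← Real.exp_nat_mul]
      apply Real.exp_le_exp.mpr
      have := Real.log_two_gt_d9
      nlinarith [Nat.cast_nonneg (α := ℝ) kk]) (by
      have h1 : (100 : ℝ) ^ (8256962560000000 * T ^ 7 * kk) ≤ N := by
        have h100 : Real.log 100 ≤ 5 := by
          rw [Real.log_le_iff_le_exp (by norm_num)]
          exact le_trans (by norm_num) (le_exp_nat 5)
        rw [← Real.log_le_log_iff (by positivity) hNp, Real.log_pow]
        push_cast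
        have h2 : (T : ℝ) ^ 7 * kk ≤ 2187 * l ^ 7 * (2 * ((1 / 10 ^ 21) / l ^ 7 * Real.log N)) :=
          mul_le_mul hT7 hk3 (Nat.cast_nonneg _) (by positivity)
        have h3 : 2187 * l ^ 7 * (2 * ((1 / 10 ^ 21) / l ^ 7 * Real.log N)) = 4374 / 10 ^ 21 * Real.log N := by
          field_simp; ring
        rw [h3] at h2
        calc 8256962560000000 * (T : ℝ) ^ 7 * kk * Real.log 100 ≤ 8256962560000000 * (T : ℝ) ^ 7 * kk * 5 := by
              apply mul_le_mul_of_nonneg_left h100; positivity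
          _ = 8256962560000000 * 5 * ((T : ℝ) ^ 7 * kk) := by ring
          _ ≤ 8256962560000000 * 5 * (4374 / 10 ^ 21 * Real.log N) := by gcongr
          _ ≤ Real.log N := by
              rw [← mul_assoc]
              exact mul_le_of_le_one_left hlogN (by norm_num)
      have h2 : 100 ^ (8256962560000000 * T ^ 7 * kk) ≤ N := by exact_mod_cast h1
      omega)
  exact ⟨a, d, L, hd, hLX, had⟩

end fin

/-- **Theorem 4 (long arithmetic progressions in `A+A+A`)**: there are constants `C, c > 0` such
that for every `N ≥ 1` and every nonempty `A ⊆ {1, …, N}` of density `α = |A|/N`, the sumset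
`A + A + A` contains an arithmetic progression with nonzero common difference of length at least
`exp(-C ⌞α⌟^2) N^(c / ⌞α⌟^7)`. -/
theorem long_ap_in_threefold_sumset :
    ∃ C c : ℝ, 0 < C ∧ 0 < c ∧
      ∀ N : ℕ, 0 < N → ∀ A ⊆ Finset.Icc 1 N, A.Nonempty →
        ∀ α : ℝ, α = (A.card : ℝ) / N →
          ∃ (a d L : ℕ), 0 < d ∧
            Real.exp (-C * lo α ^ 2) * (N : ℝ) ^ (c / lo α ^ 7) ≤ (L : ℝ) ∧
            ∀ i < L, a + i * d ∈ A + A + A := by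
  exact long_ap_core
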